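/- arXiv:1709.09532 — 7 statements merged into one kernel-verified Lean document; each statement's English description precedes it below -/
import Mathlib

section
/- Let 1 < p < ∞ and let (X_i)_{i ∈ ι} be a family of normed real vector spaces, each of which is strictly convex. Then the ℓ^p-direct sum lp X p (the space of families (x_i) with Σ ‖x_i‖^p < ∞, normed by (Σ ‖x_i‖^p)^{1/p}) is strictly convex. -/
open scoped ENNReal

/-- A normed real vector space is strictly convex: for all `x`, `y` in the unit sphere
with `x ≠ y` one has `‖x + y‖ < 2`. -/
def IsStrictlyConvex (X : Type*) [NormedAddCommGroup X] [NormedSpace ℝ X] : Prop :=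
  ∀ x y : X, ‖x‖ = 1 → ‖y‖ = 1 → x ≠ y → ‖x + y‖ < 2

theorem IsStrictlyConvex.strictConvexSpace {E : Type*} [NormedAddCommGroup E] [NormedSpace ℝ E]
    (h : IsStrictlyConvex E) : StrictConvexSpace ℝ E :=
  StrictConvexSpace.of_norm_add_ne_two fun x y hx hy hxy => (h x y hx hy hxy).ne

theorem norm_add_div_two_rpow_lt {E : Type*} [NormedAddCommGroup E] [NormedSpace ℝ E]
    [StrictConvexSpace ℝ E] {q : ℝ} (hq : 1 < q) {x y : E} (hxy : x ≠ y) :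
    (‖x + y‖ / 2) ^ q < (‖x‖ ^ q + ‖y‖ ^ q) / 2 := by
  have hq0 : 0 < q := zero_lt_one.trans hq
  by_cases h : ‖x‖ = ‖y‖
  · have hlt : ‖x + y‖ < ‖x‖ + ‖y‖ := (norm_add_le x y).lt_of_ne fun h' =>
      hxy (eq_of_norm_eq_of_norm_add_eq h h')
    calc (‖x + y‖ / 2) ^ q < ‖x‖ ^ q :=
          Real.rpow_lt_rpow (by positivity) (by linarith) hq0
      _ = (‖x‖ ^ q + ‖y‖ ^ q) / 2 := by rw [← h]; ring
  · have hconv := (strictConvexOn_rpow hq).2 (norm_nonneg x) (norm_nonneg y) h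
      (half_pos one_pos) (half_pos one_pos) (add_halves 1)
    simp only [smul_eq_mul] at hconv
    calc (‖x + y‖ / 2) ^ q ≤ (1 / 2 * ‖x‖ + 1 / 2 * ‖y‖) ^ q :=
          Real.rpow_le_rpow (by positivity) (by linarith [norm_add_le x y]) hq0.le
      _ < 1 / 2 * ‖x‖ ^ q + 1 / 2 * ‖y‖ ^ q := hconv
      _ = (‖x‖ ^ q + ‖y‖ ^ q) / 2 := by ring

theorem norm_add_div_two_rpow_le {E : Type*} [NormedAddCommGroup E] [NormedSpace ℝ E]
    [StrictConvexSpace ℝ E] {q : ℝ} (hq : 1 < q) (x y : E) :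
    (‖x + y‖ / 2) ^ q ≤ (‖x‖ ^ q + ‖y‖ ^ q) / 2 := by
  obtain rfl | hxy := eq_or_ne x y
  · rw [← two_smul ℝ x, norm_smul, Real.norm_ofNat, mul_div_cancel_left₀ _ two_ne_zero,
      add_self_div_two]
  · exact (norm_add_div_two_rpow_lt hq hxy).le

/-- If `1 < p < ∞` and each `X i` is a strictly convex normed real vector space, then the
`ℓ^p`-direct sum `lp X p` is strictly convex. -/
theorem lp_strictlyConvex {ι : Type*} (X : ι → Type*)
    [∀ i, NormedAddCommGroup (X i)] [∀ i, NormedSpace ℝ (X i)]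
    (p : ℝ≥0∞) [Fact (1 ≤ p)] (hp : 1 < p) (hp' : p ≠ ⊤)
    (hX : ∀ i, IsStrictlyConvex (X i)) :
    IsStrictlyConvex (lp X p) := by
  have _ (i : ι) : StrictConvexSpace ℝ (X i) := (hX i).strictConvexSpace
  have hq : 1 < p.toReal := by
    simpa using (ENNReal.toReal_lt_toReal ENNReal.one_ne_top hp').2 hp
  have hq0 : 0 < p.toReal := zero_lt_one.trans hq
  intro x y hx hy hxy
  obtain ⟨i, hi⟩ : ∃ i, x i ≠ y i := by
    by_contra! h
    exact hxy (lp.ext (funext h))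
  have hadd : HasSum (fun i => (‖x i + y i‖ / 2) ^ p.toReal) ((‖x + y‖ / 2) ^ p.toReal) := by
    simpa [Real.div_rpow] using
      (lp.hasSum_norm hq0 (x + y)).div_const (2 ^ p.toReal)
  have hmid : HasSum (fun i => (‖x i‖ ^ p.toReal + ‖y i‖ ^ p.toReal) / 2) 1 := by
    simpa [hx, hy] using ((lp.hasSum_norm hq0 x).add (lp.hasSum_norm hq0 y)).div_const 2
  have hlt := hasSum_lt (fun i => norm_add_div_two_rpow_le hq (x i) (y i))
    (norm_add_div_two_rpow_lt hq hi) hadd hmid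
  by_contra! h
  exact hlt.not_ge (Real.one_le_rpow (by linarith) hq0.le)
end

section
/- Let 1 < p < ∞ and let (X_i)_{i ∈ ι} be a family of real Banach spaces, each of which is locally uniformly convex. Then the ℓ^p-direct sum lp X p is locally uniformly convex. -/
open scoped ENNReal
open Filter

/-- A Banach space is locally uniformly convex (LUC) if for every sequence `(xₙ)` in the unit
sphere and every `x` in the unit sphere with `‖xₙ + x‖ → 2` one has `‖xₙ − x‖ → 0`. -/
def LocallyUniformlyConvex (X : Type*) [NormedAddCommGroup X] [NormedSpace ℝ X] : Prop :=
  ∀ (x : X), ‖x‖ = 1 → ∀ (xs : ℕ → X), (∀ n, ‖xs n‖ = 1) →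
    Tendsto (fun n => ‖xs n + x‖) atTop (nhds 2) →
    Tendsto (fun n => ‖xs n - x‖) atTop (nhds 0)

/-- Midpoint convexity of `t ↦ t ^ q` on the nonnegative reals. -/
lemma Real.rpow_half_add_le {q a b : ℝ} (hq : 1 ≤ q) (ha : 0 ≤ a) (hb : 0 ≤ b) :
    ((a + b) / 2) ^ q ≤ (a ^ q + b ^ q) / 2 := by
  have h := (convexOn_rpow hq).2 (Set.mem_Ici.2 ha) (Set.mem_Ici.2 hb)
    (by norm_num : (0 : ℝ) ≤ 1 / 2) (by norm_num : (0 : ℝ) ≤ 1 / 2) (by norm_num)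
  simp only [smul_eq_mul] at h
  rw [show (a + b) / 2 = 1 / 2 * a + 1 / 2 * b by ring]
  linarith

/-- Strict midpoint convexity of `t ↦ t ^ q` on the nonnegative reals. -/
lemma Real.rpow_half_add_lt {q a b : ℝ} (hq : 1 < q) (ha : 0 ≤ a) (hb : 0 ≤ b) (hab : a ≠ b) :
    ((a + b) / 2) ^ q < (a ^ q + b ^ q) / 2 := by
  have h := (strictConvexOn_rpow hq).2 (Set.mem_Ici.2 ha) (Set.mem_Ici.2 hb) hab
    (by norm_num : (0 : ℝ) < 1 / 2) (by norm_num : (0 : ℝ) < 1 / 2) (by norm_num)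
  simp only [smul_eq_mul] at h
  rw [show (a + b) / 2 = 1 / 2 * a + 1 / 2 * b by ring]
  linarith

lemma tendsto_of_rpow_midpoint_gap_tendsto_zero {q b M : ℝ} {a : ℕ → ℝ} (hq : 1 < q)
    (hb : 0 ≤ b) (ha : ∀ n, 0 ≤ a n) (haM : ∀ n, a n ≤ M)
    (h : Tendsto (fun n => (a n ^ q + b ^ q) / 2 - ((a n + b) / 2) ^ q) atTop (nhds 0)) :
    Tendsto a atTop (nhds b) := by
  refine (isCompact_Icc (a := (0 : ℝ)) (b := M)).tendsto_nhds_of_unique_mapClusterPt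
    (Eventually.of_forall fun n => ⟨ha n, haM n⟩) fun t ht hcl => ?_
  have hq0 : 0 ≤ q := by linarith
  have hcont : Continuous fun t : ℝ => (t ^ q + b ^ q) / 2 - ((t + b) / 2) ^ q :=
    (((Real.continuous_rpow_const hq0).add continuous_const).div_const 2).sub
      ((Real.continuous_rpow_const hq0).comp ((continuous_id.add continuous_const).div_const 2))
  have hgap := hcl.continuousAt_comp hcont.continuousAt
  have hzero : (t ^ q + b ^ q) / 2 - ((t + b) / 2) ^ q = 0 :=
    eq_of_nhds_neBot (ClusterPt.mono hgap h)
  by_contra hne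
  linarith [Real.rpow_half_add_lt hq ht.1 hb hne]

/-- In a locally uniformly convex space, convergence of norms and of the norms of midpoints
implies norm convergence, without normalization. -/
lemma LocallyUniformlyConvex.tendsto_of_tendsto_norm {X : Type*} [NormedAddCommGroup X]
    [NormedSpace ℝ X] (hX : LocallyUniformlyConvex X) {v : X} {u : ℕ → X}
    (hu : Tendsto (fun n => ‖u n‖) atTop (nhds ‖v‖))
    (huv : Tendsto (fun n => ‖u n + v‖) atTop (nhds (2 * ‖v‖))) :
    Tendsto u atTop (nhds v) := by
  classical
  rcases eq_or_ne v 0 with rfl | hv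
  · rw [norm_zero] at hu
    exact tendsto_zero_iff_norm_tendsto_zero.2 hu
  have hb : 0 < ‖v‖ := norm_pos_iff.2 hv
  set e : X := ‖v‖⁻¹ • v with he
  have he1 : ‖e‖ = 1 := by rw [he, norm_smul, norm_inv, norm_norm, inv_mul_cancel₀ hb.ne']
  have hve : ‖v‖ • e = v := by rw [he, smul_smul, mul_inv_cancel₀ hb.ne', one_smul]
  set w : ℕ → X := fun n => if u n = 0 then e else ‖u n‖⁻¹ • u n with hw
  have hw1 : ∀ n, ‖w n‖ = 1 := fun n => by
    by_cases h0 : u n = 0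
    · simp [hw, h0, he1]
    · simp [hw, h0, norm_smul]
  have hwu : ∀ n, ‖u n‖ • w n = u n := fun n => by
    by_cases h0 : u n = 0
    · simp [h0]
    · simp [hw, h0, smul_smul]
  have hdiff : Tendsto (fun n => ‖‖v‖ • w n + v‖ - ‖u n + v‖) atTop (nhds 0) := by
    have hsub : Tendsto (fun n => |‖v‖ - ‖u n‖|) atTop (nhds 0) := by
      simpa using (hu.const_sub ‖v‖).abs
    refine squeeze_zero_norm (fun n => ?_) hsub
    calc ‖‖‖v‖ • w n + v‖ - ‖u n + v‖‖ ≤ ‖(‖v‖ • w n + v) - (u n + v)‖ := abs_norm_sub_norm_le _ _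
      _ = ‖(‖v‖ - ‖u n‖) • w n‖ := by
        rw [add_sub_add_right_eq_sub, sub_smul, hwu]
      _ = |‖v‖ - ‖u n‖| := by rw [norm_smul, hw1, mul_one, Real.norm_eq_abs]
  have hwe : Tendsto (fun n => ‖w n + e‖) atTop (nhds 2) := by
    have h := (hdiff.add huv).const_mul ‖v‖⁻¹
    have hlim : ‖v‖⁻¹ * (0 + 2 * ‖v‖) = 2 := by field_simp; ring
    rw [hlim] at h
    refine h.congr fun n => ?_
    have : ‖v‖ • w n + v = ‖v‖ • (w n + e) := by rw [smul_add, hve]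
    rw [sub_add_cancel, this, norm_smul, norm_norm, inv_mul_cancel_left₀ hb.ne']
  have hlim := hu.smul (tendsto_iff_norm_sub_tendsto_zero.2 (hX e he1 w hw1 hwe))
  rw [hve] at hlim
  exact hlim.congr hwu

lemma LocallyUniformlyConvex.tendsto_of_rpow_gap {X : Type*} [NormedAddCommGroup X]
    [NormedSpace ℝ X] (hX : LocallyUniformlyConvex X) {q M : ℝ} (hq : 1 < q) {v : X} {u : ℕ → X}
    (hM : ∀ n, ‖u n‖ ≤ M)
    (h : Tendsto (fun n => (‖u n‖ ^ q + ‖v‖ ^ q) / 2 - (‖u n + v‖ / 2) ^ q) atTop (nhds 0)) :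
    Tendsto u atTop (nhds v) := by
  have hq0 : 0 < q := by linarith
  have hu : Tendsto (fun n => ‖u n‖) atTop (nhds ‖v‖) := by
    refine tendsto_of_rpow_midpoint_gap_tendsto_zero hq (norm_nonneg v) (fun n => norm_nonneg _)
      hM (squeeze_zero (fun n => ?_) (fun n => ?_) h)
    · linarith [Real.rpow_half_add_le hq.le (norm_nonneg (u n)) (norm_nonneg v)]
    · gcongr
      exact norm_add_le _ _
  refine hX.tendsto_of_tendsto_norm hu ?_
  have hpow : Tendsto (fun n => (‖u n + v‖ / 2) ^ q) atTop (nhds (‖v‖ ^ q)) := by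
    have hsum := ((((hu.rpow_const (Or.inr hq0.le)).add_const (‖v‖ ^ q)).div_const 2).sub h)
    simpa using hsum
  have hroot := (hpow.rpow_const (p := q⁻¹) (Or.inr (inv_nonneg.2 hq0.le))).const_mul 2
  rw [Real.rpow_rpow_inv (norm_nonneg v) hq0.ne'] at hroot
  refine hroot.congr fun n => ?_
  rw [Real.rpow_rpow_inv (by positivity) hq0.ne']
  ring

/-- Radon–Riesz property of `ℓ^p`-sums with respect to coordinatewise norm convergence. -/
lemma lp.tendsto_of_tendsto_coord_of_tendsto_norm {ι : Type*} {X : ι → Type*}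
    [∀ i, NormedAddCommGroup (X i)] {p : ℝ≥0∞} [Fact (1 ≤ p)] (hp' : p ≠ ⊤)
    {x : lp X p} {xs : ℕ → lp X p}
    (hcoord : ∀ i, Tendsto (fun n => xs n i) atTop (nhds (x i)))
    (hnorm : Tendsto (fun n => ‖xs n‖) atTop (nhds ‖x‖)) :
    Tendsto xs atTop (nhds x) := by
  set q := p.toReal
  have hq : 1 ≤ q := by
    simpa using ENNReal.toReal_mono hp' (Fact.out : 1 ≤ p)
  have hq0 : 0 < q := by linarith
  let g : ℕ → ι → ℝ := fun n i =>
    2 ^ q * ((‖xs n i‖ ^ q + ‖x i‖ ^ q) / 2) - ‖xs n i - x i‖ ^ q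
  have hgsum : ∀ n, HasSum (g n) (2 ^ q * ((‖xs n‖ ^ q + ‖x‖ ^ q) / 2) - ‖xs n - x‖ ^ q) :=
    fun n => ((((lp.hasSum_norm hq0 (xs n)).add (lp.hasSum_norm hq0 x)).div_const 2).mul_left
      (2 ^ q)).sub (lp.hasSum_norm hq0 (xs n - x))
  have hg0 : ∀ n i, 0 ≤ g n i := fun n i => by
    have h1 : (‖xs n i - x i‖ / 2) ^ q ≤ (‖xs n i‖ ^ q + ‖x i‖ ^ q) / 2 :=
      (Real.rpow_le_rpow (by positivity) (by gcongr; exact norm_sub_le _ _) hq0.le).trans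
        (Real.rpow_half_add_le hq (norm_nonneg _) (norm_nonneg _))
    rw [Real.div_rpow (norm_nonneg _) (by norm_num), div_le_iff₀' (by positivity)] at h1
    exact sub_nonneg.2 h1
  have hglim : ∀ i, Tendsto (fun n => g n i) atTop (nhds (2 ^ q * ‖x i‖ ^ q)) := fun i => by
    have h1 := ((hcoord i).norm.rpow_const (p := q) (Or.inr hq0.le))
    have h2 := (((hcoord i).sub_const (x i)).norm.rpow_const (p := q) (Or.inr hq0.le))
    have h3 := (((h1.add_const (‖x i‖ ^ q)).div_const 2).const_mul (2 ^ q)).sub h2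
    simpa [Real.zero_rpow hq0.ne'] using h3
  have hpow : Tendsto (fun n => ‖xs n - x‖ ^ q) atTop (nhds 0) := by
    refine tendsto_order.2 ⟨fun c hc => Eventually.of_forall fun n => hc.trans_le (by positivity),
      fun ε hε => ?_⟩
    have htail : ∀ᶠ s : Finset ι in atTop,
        2 ^ q * ‖x‖ ^ q - ε / 2 < ∑ i ∈ s, 2 ^ q * ‖x i‖ ^ q :=
      ((lp.hasSum_norm hq0 x).mul_left (2 ^ q)).eventually_const_lt (by linarith)
    obtain ⟨s, hs⟩ := htail.exists
    have hN : Tendsto (fun n => 2 ^ q * ((‖xs n‖ ^ q + ‖x‖ ^ q) / 2)) atTop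
        (nhds (2 ^ q * ‖x‖ ^ q)) := by
      simpa using (((hnorm.rpow_const (p := q) (Or.inr hq0.le)).add_const
        (‖x‖ ^ q)).div_const 2).const_mul (2 ^ q)
    filter_upwards [(tendsto_finsetSum s fun i _ => hglim i).eventually_const_lt hs,
      hN.eventually_lt_const (show _ < 2 ^ q * ‖x‖ ^ q + ε / 2 by linarith)] with n hn hn'
    linarith [sum_le_hasSum s (fun i _ => hg0 n i) (hgsum n)]
  rw [tendsto_iff_norm_sub_tendsto_zero]
  have hroot := hpow.rpow_const (p := q⁻¹) (Or.inr (inv_nonneg.2 hq0.le))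
  rw [Real.zero_rpow (inv_ne_zero hq0.ne')] at hroot
  exact hroot.congr fun n => Real.rpow_rpow_inv (norm_nonneg _) hq0.ne'

/-- If `1 < p < ∞` and each `X i` is a locally uniformly convex real Banach space, then the
`ℓ^p`-direct sum `lp X p` is locally uniformly convex. -/
theorem lp_locallyUniformlyConvex {ι : Type*} (X : ι → Type*)
    [∀ i, NormedAddCommGroup (X i)] [∀ i, NormedSpace ℝ (X i)] [∀ i, CompleteSpace (X i)]
    (p : ℝ≥0∞) [Fact (1 ≤ p)] (hp : 1 < p) (hp' : p ≠ ⊤)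
    (hX : ∀ i, LocallyUniformlyConvex (X i)) :
    LocallyUniformlyConvex (lp X p) := by
  intro x hx xs hxs hlim
  have hq : 1 < p.toReal := by
    simpa using (ENNReal.toReal_lt_toReal ENNReal.one_ne_top hp').2 hp
  set q := p.toReal
  have hq0 : 0 < q := by linarith
  set gap : ℕ → ι → ℝ := fun n i =>
    (‖xs n i‖ ^ q + ‖x i‖ ^ q) / 2 - (‖xs n i + x i‖ / 2) ^ q with hgap
  have hgap0 : ∀ n i, 0 ≤ gap n i := fun n i => sub_nonneg.2 <|
    (Real.rpow_le_rpow (by positivity) (by gcongr; exact norm_add_le _ _) hq0.le).trans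
      (Real.rpow_half_add_le hq.le (norm_nonneg _) (norm_nonneg _))
  have hgapsum : ∀ n, HasSum (gap n) (1 - (‖xs n + x‖ / 2) ^ q) := fun n => by
    have h := (((lp.hasSum_norm hq0 (xs n)).add (lp.hasSum_norm hq0 x)).div_const 2).sub
      ((lp.hasSum_norm hq0 (xs n + x)).div_const (2 ^ q))
    rw [hxs n, hx, Real.one_rpow, add_self_div_two,
      ← Real.div_rpow (norm_nonneg _) (by norm_num)] at h
    refine h.congr_fun fun i => ?_
    simp only [hgap, Real.div_rpow (norm_nonneg _) (zero_le_two (α := ℝ))]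
    rfl
  have htotal : Tendsto (fun n => 1 - (‖xs n + x‖ / 2) ^ q) atTop (nhds 0) := by
    simpa using ((hlim.div_const 2).rpow_const (p := q) (Or.inr hq0.le)).const_sub 1
  have hp0 : p ≠ 0 := (zero_lt_one.trans hp).ne'
  have hcoord : ∀ i, Tendsto (fun n => xs n i) atTop (nhds (x i)) := fun i =>
    (hX i).tendsto_of_rpow_gap hq (M := 1)
      (fun n => (lp.norm_apply_le_norm hp0 (xs n) i).trans_eq (hxs n))
      (squeeze_zero (fun n => hgap0 n i)
        (fun n => le_hasSum (hgapsum n) i fun j _ => hgap0 n j) htotal)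
  refine tendsto_iff_norm_sub_tendsto_zero.1
    (lp.tendsto_of_tendsto_coord_of_tendsto_norm hp' hcoord ?_)
  simp [hxs, hx]
end

section
/- Let 1 < p < ∞ and let (X_i)_{i ∈ ι} be a family of real Banach spaces, each of which is midpoint locally uniformly convex. Then the ℓ^p-direct sum lp X p is midpoint locally uniformly convex. -/
open scoped ENNReal
open Filter

/-- A Banach space is midpoint locally uniformly convex (MLUC) if whenever `x ∈ X` and `(xₙ)`
is a sequence in `X` with `‖xₙ + x‖ → ‖x‖` and `‖xₙ − x‖ → ‖x‖`, then `‖xₙ‖ → 0`. -/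
def MidpointLocallyUniformlyConvex (X : Type*) [NormedAddCommGroup X] [NormedSpace ℝ X] : Prop :=
  ∀ (x : X) (xs : ℕ → X),
    Tendsto (fun n => ‖xs n + x‖) atTop (nhds ‖x‖) →
    Tendsto (fun n => ‖xs n - x‖) atTop (nhds ‖x‖) →
    Tendsto (fun n => ‖xs n‖) atTop (nhds 0)

/-- If `aₙ, bₙ ≥ 0` have average at least `c ≥ 0` and their `q`-th powers have average tending to
`c ^ q`, where `1 < q`, then both sequences tend to `c`. -/
theorem tendsto_prodMk_of_tendsto_rpow_add_rpow {q : ℝ} (hq : 1 < q) {c : ℝ} (hc : 0 ≤ c)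
    {a b : ℕ → ℝ} (ha : ∀ n, 0 ≤ a n) (hb : ∀ n, 0 ≤ b n) (hab : ∀ n, 2 * c ≤ a n + b n)
    (h : Tendsto (fun n => a n ^ q + b n ^ q) atTop (nhds (2 * c ^ q))) :
    Tendsto (fun n => (a n, b n)) atTop (nhds (c, c)) := by
  have hq0 : 0 < q := by linarith
  set R : ℝ := (2 * c ^ q + 1) ^ q⁻¹ with hR
  have hle : ∀ u : ℝ, 0 ≤ u → u ^ q ≤ 2 * c ^ q + 1 → u ≤ R := fun u hu h1 => by
    rw [hR, Real.le_rpow_inv_iff_of_pos hu (by positivity) hq0]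
    exact h1
  have hcpt : IsCompact ((Set.Icc 0 R ×ˢ Set.Icc 0 R) ∩ {z : ℝ × ℝ | 2 * c ≤ z.1 + z.2}) :=
    (isCompact_Icc.prod isCompact_Icc).inter_right
      (isClosed_le continuous_const (continuous_fst.add continuous_snd))
  refine hcpt.tendsto_nhds_of_unique_mapClusterPt ?_ ?_
  · filter_upwards [h.eventually_le_const (lt_add_one _)] with n hn
    have h1 := Real.rpow_nonneg (ha n) q
    have h2 := Real.rpow_nonneg (hb n) q
    exact ⟨⟨⟨ha n, hle _ (ha n) (by linarith)⟩, ⟨hb n, hle _ (hb n) (by linarith)⟩⟩, hab n⟩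
  · rintro ⟨u, v⟩ ⟨⟨⟨hu, -⟩, ⟨hv, -⟩⟩, huv⟩ hcl
    simp only [Set.mem_ofPred_eq] at hu hv huv
    have hcont : Continuous fun z : ℝ × ℝ => z.1 ^ q + z.2 ^ q :=
      (continuous_fst.rpow_const fun _ => Or.inr hq0.le).add
        (continuous_snd.rpow_const fun _ => Or.inr hq0.le)
    have heq : u ^ q + v ^ q = 2 * c ^ q :=
      eq_of_nhds_neBot ((hcl.continuousAt_comp hcont.continuousAt).clusterPt.mono h)
    have hmid : c ^ q ≤ ((1 / 2) * u + (1 / 2) * v) ^ q :=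
      Real.rpow_le_rpow hc (by linarith) hq0.le
    have huv' : u = v := by
      by_contra hne
      have := (strictConvexOn_rpow hq).2 hu hv hne
        (one_half_pos (α := ℝ)) (one_half_pos (α := ℝ)) (add_halves 1)
      simp only [smul_eq_mul] at this
      linarith
    subst huv'
    have : u = c := (Real.rpow_left_inj hu hc hq0.ne').1 (by linarith)
    rw [this]

/-- Midpoint convexity of `t ↦ t ^ q`, combined with its monotonicity. -/
theorem rpow_le_half_rpow_add_rpow {q : ℝ} (hq : 1 ≤ q) {a b c : ℝ} (hc : 0 ≤ c)
    (ha : 0 ≤ a) (hb : 0 ≤ b) (h : 2 * c ≤ a + b) : c ^ q ≤ (a ^ q + b ^ q) / 2 := by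
  have h1 : c ^ q ≤ ((1 / 2) * a + (1 / 2) * b) ^ q :=
    Real.rpow_le_rpow hc (by linarith) (by linarith)
  have h2 := (convexOn_rpow hq).2 ha hb
    (one_half_pos (α := ℝ)).le (one_half_pos (α := ℝ)).le (add_halves 1)
  simp only [smul_eq_mul] at h2
  linarith

theorem two_mul_norm_le_norm_add_add_norm_sub {E : Type*} [NormedAddCommGroup E]
    [NormedSpace ℝ E] (y x : E) : 2 * ‖x‖ ≤ ‖y + x‖ + ‖y - x‖ := by
  have h := norm_sub_le (y + x) (y - x)
  rw [show y + x - (y - x) = (2 : ℝ) • x by rw [two_smul]; abel, norm_smul] at h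
  simpa using h

/-- If `1 < p < ∞` and each `X i` is a midpoint locally uniformly convex real Banach space,
then the `ℓ^p`-direct sum `lp X p` is midpoint locally uniformly convex. -/
theorem lp_midpointLocallyUniformlyConvex {ι : Type*} (X : ι → Type*)
    [∀ i, NormedAddCommGroup (X i)] [∀ i, NormedSpace ℝ (X i)] [∀ i, CompleteSpace (X i)]
    (p : ℝ≥0∞) [Fact (1 ≤ p)] (hp : 1 < p) (hp' : p ≠ ⊤)
    (hX : ∀ i, MidpointLocallyUniformlyConvex (X i)) :
    MidpointLocallyUniformlyConvex (lp X p) := by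
  intro x xs hadd hsub
  have hq : 1 < p.toReal := by
    simpa using (ENNReal.toReal_lt_toReal ENNReal.one_ne_top hp').2 hp
  have hq0 : 0 < p.toReal := by linarith
  set q := p.toReal
  let D : ℕ → ι → ℝ := fun n i => (‖xs n i + x i‖ ^ q + ‖xs n i - x i‖ ^ q) / 2 - ‖x i‖ ^ q
  have hDsum : ∀ n, HasSum (D n) ((‖xs n + x‖ ^ q + ‖xs n - x‖ ^ q) / 2 - ‖x‖ ^ q) := fun n =>
    (((lp.hasSum_norm hq0 (xs n + x)).add (lp.hasSum_norm hq0 (xs n - x))).div_const 2).sub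
      (lp.hasSum_norm hq0 x)
  have hD0 : ∀ n i, 0 ≤ D n i := fun n i => sub_nonneg.2 <|
    rpow_le_half_rpow_add_rpow hq.le (norm_nonneg _) (norm_nonneg _) (norm_nonneg _)
      (two_mul_norm_le_norm_add_add_norm_sub _ _)
  have hxs : ∀ n i, ‖xs n i‖ ^ q ≤ D n i + ‖x i‖ ^ q := fun n i => by
    have h := two_mul_norm_le_norm_add_add_norm_sub (x i) (xs n i)
    rw [add_comm (x i), norm_sub_rev (x i)] at h
    have := rpow_le_half_rpow_add_rpow hq.le (norm_nonneg _) (norm_nonneg _) (norm_nonneg _) h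
    simpa [D] using this
  have hDtot : Tendsto (fun n => ∑' i, D n i) atTop (nhds 0) := by
    have h := (((hadd.rpow_const (Or.inr hq0.le)).add
      (hsub.rpow_const (Or.inr hq0.le))).div_const 2).sub_const (‖x‖ ^ q)
    simp only [fun n => (hDsum n).tsum_eq]
    convert h using 2
    ring
  have hDi : ∀ i, Tendsto (fun n => D n i) atTop (nhds 0) := fun i =>
    squeeze_zero (fun n => hD0 n i)
      (fun n => (hDsum n).summable.le_tsum i fun j _ => hD0 n j) hDtot
  have hcoord : ∀ i, Tendsto (fun n => ‖xs n i‖) atTop (nhds 0) := fun i => by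
    have hpow : Tendsto (fun n => ‖xs n i + x i‖ ^ q + ‖xs n i - x i‖ ^ q) atTop
        (nhds (2 * ‖x i‖ ^ q)) := by
      have h := ((hDi i).add_const (‖x i‖ ^ q)).const_mul 2
      rw [zero_add] at h
      refine h.congr fun n => ?_
      simp only [D]
      ring
    have hprod := tendsto_prodMk_of_tendsto_rpow_add_rpow hq (norm_nonneg (x i))
      (fun n => norm_nonneg _) (fun n => norm_nonneg _)
      (fun n => two_mul_norm_le_norm_add_add_norm_sub (xs n i) (x i)) hpow
    exact hX i (x i) (fun n => xs n i) hprod.fst_nhds hprod.snd_nhds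
  let M : ℕ → ι → ℝ := fun n i => max (‖xs n i‖ ^ q - D n i) 0
  have hMbound : ∀ n i, ‖M n i‖ ≤ ‖x i‖ ^ q := fun n i => by
    rw [Real.norm_of_nonneg (le_max_right _ _)]
    exact max_le (by linarith [hxs n i]) (by positivity)
  have hxsum : Summable fun i => ‖x i‖ ^ q := (lp.hasSum_norm hq0 x).summable
  have hMtot : Tendsto (fun n => ∑' i, M n i) atTop (nhds 0) := by
    have h := tendsto_tsum_of_dominated_convergence (𝓕 := atTop) (f := M) (g := fun _ => 0) hxsum
      (fun i => by
        have h := (((hcoord i).rpow_const (Or.inr hq0.le)).sub (hDi i)).max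
          (tendsto_const_nhds (x := (0 : ℝ)))
        simpa [Real.zero_rpow hq0.ne'] using h)
      (Eventually.of_forall hMbound)
    simpa using h
  have hMsum : ∀ n, Summable (M n) := fun n => hxsum.of_norm_bounded (hMbound n)
  have hnorm : Tendsto (fun n => ‖xs n‖ ^ q) atTop (nhds 0) := by
    refine squeeze_zero (fun n => by positivity) (fun n => ?_)
      (by simpa using hDtot.add hMtot)
    rw [← (lp.hasSum_norm hq0 (xs n)).tsum_eq, ← (hDsum n).summable.tsum_add (hMsum n)]
    refine (lp.hasSum_norm hq0 (xs n)).summable.tsum_le_tsum (fun i => ?_)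
      ((hDsum n).summable.add (hMsum n))
    linarith [le_max_left (‖xs n i‖ ^ q - D n i) 0]
  have h := hnorm.rpow_const (p := q⁻¹) (Or.inr (inv_nonneg.2 hq0.le))
  rw [Real.zero_rpow (inv_ne_zero hq0.ne')] at h
  exact h.congr fun n => Real.rpow_rpow_inv (norm_nonneg _) hq0.ne'
end

section
/- Let (S, 𝒜, μ) be a measure space, let 1 < p < ∞, and let X be a midpoint locally uniformly convex real Banach space. Then the Lebesgue–Bochner space L^p(μ, X) is midpoint locally uniformly convex. -/
open scoped ENNReal
open Filter MeasureTheory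

/-- If the averages `(aₙ + bₙ) / 2` of nonnegative sequences stay above `r ≥ 0` while the averages
of their `q`-th powers, `q > 1`, tend to `r ^ q`, then both sequences tend to `r`. -/
lemma tendsto_of_tendsto_avg_rpow {q r : ℝ} (hq : 1 < q) (hr : 0 ≤ r) {a b : ℕ → ℝ}
    (ha : ∀ n, 0 ≤ a n) (hb : ∀ n, 0 ≤ b n) (hab : ∀ n, r ≤ (a n + b n) / 2)
    (h : Tendsto (fun n => (a n ^ q + b n ^ q) / 2) atTop (nhds (r ^ q))) :
    Tendsto a atTop (nhds r) ∧ Tendsto b atTop (nhds r) := by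
  have hq0 : 0 < q := zero_lt_one.trans hq
  suffices H : Tendsto (fun n => (a n, b n)) atTop (nhds (r, r)) by
    rwa [nhds_prod_eq, tendsto_prod_iff'] at H
  refine tendsto_of_subseq_tendsto fun ns hns => ?_
  obtain ⟨C, hC⟩ := h.bddAbove_range
  have hbound : ∀ t : ℝ, 0 ≤ t → t ^ q ≤ 2 * C → t ≤ (2 * C) ^ q⁻¹ := fun t ht htC =>
    (Real.le_rpow_inv_iff_of_pos ht ((Real.rpow_nonneg ht q).trans htC) hq0).2 htC
  have hmem : ∀ n, (a (ns n), b (ns n)) ∈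
      Set.Icc (0 : ℝ) ((2 * C) ^ q⁻¹) ×ˢ Set.Icc (0 : ℝ) ((2 * C) ^ q⁻¹) := by
    intro n
    have h1 : (a (ns n) ^ q + b (ns n) ^ q) / 2 ≤ C := hC ⟨ns n, rfl⟩
    have h2 := Real.rpow_nonneg (ha (ns n)) q
    have h3 := Real.rpow_nonneg (hb (ns n)) q
    exact ⟨⟨ha _, hbound _ (ha _) (by linarith)⟩, ⟨hb _, hbound _ (hb _) (by linarith)⟩⟩
  obtain ⟨⟨A, B⟩, hAB, φ, hφ, hlim⟩ := (isCompact_Icc.prod isCompact_Icc).tendsto_subseq hmem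
  refine ⟨φ, ?_⟩
  have hlim' := hlim
  rw [nhds_prod_eq, tendsto_prod_iff'] at hlim'
  obtain ⟨hA, hB⟩ := hlim'
  simp only [Function.comp_def] at hA hB
  have hpow : (A ^ q + B ^ q) / 2 = r ^ q :=
    tendsto_nhds_unique
      (((hA.rpow_const (Or.inr hq0.le)).add (hB.rpow_const (Or.inr hq0.le))).div_const 2)
      (h.comp (hns.comp hφ.tendsto_atTop))
  have hle : r ≤ (A + B) / 2 :=
    ge_of_tendsto' ((hA.add hB).div_const 2) fun n => hab _
  have hA0 : 0 ≤ A := hAB.1.1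
  have hB0 : 0 ≤ B := hAB.2.1
  have hEq : A = B := by
    by_contra hne
    have hlt := (strictConvexOn_rpow hq).2 hA0 hB0 hne
      (one_half_pos (α := ℝ)) (one_half_pos (α := ℝ)) (add_halves 1)
    simp only [smul_eq_mul] at hlt
    have hmono := Real.rpow_le_rpow hr hle hq0.le
    rw [show (1 / 2 : ℝ) * A + 1 / 2 * B = (A + B) / 2 by ring] at hlt
    linarith
  subst hEq
  have hAr : A = r := by
    rw [add_self_div_two] at hpow
    exact (Real.rpow_left_inj hA0 hr hq0.ne').1 hpow
  rw [← hAr]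
  exact hlim

/-- The convexity inequality `((a + b) / 2) ^ q ≤ (a ^ q + b ^ q) / 2` with a lower bound on the
average. -/
lemma rpow_le_avg_rpow {q c a b : ℝ} (hq : 1 ≤ q) (hc : 0 ≤ c) (ha : 0 ≤ a) (hb : 0 ≤ b)
    (h : c ≤ (a + b) / 2) : c ^ q ≤ (a ^ q + b ^ q) / 2 := by
  have hconv := (convexOn_rpow hq).2 ha hb
    (one_half_pos (α := ℝ)).le (one_half_pos (α := ℝ)).le (add_halves 1)
  simp only [smul_eq_mul] at hconv
  rw [show (1 / 2 : ℝ) * a + 1 / 2 * b = (a + b) / 2 by ring] at hconv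
  have := Real.rpow_le_rpow hc h (zero_le_one.trans hq)
  linarith

lemma norm_le_avg_norm_add_norm_sub {E : Type*} [NormedAddCommGroup E] [NormedSpace ℝ E]
    (x y : E) : ‖x‖ ≤ (‖y + x‖ + ‖y - x‖) / 2 ∧ ‖y‖ ≤ (‖y + x‖ + ‖y - x‖) / 2 := by
  have h1 : ‖(2 : ℝ) • x‖ ≤ ‖y + x‖ + ‖y - x‖ := by
    rw [show (2 : ℝ) • x = y + x - (y - x) by module]
    exact norm_sub_le _ _
  have h2 : ‖(2 : ℝ) • y‖ ≤ ‖y + x‖ + ‖y - x‖ := by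
    rw [show (2 : ℝ) • y = y + x + (y - x) by module]
    exact norm_add_le _ _
  rw [norm_smul, Real.norm_two] at h1 h2
  constructor <;> linarith

lemma MeasureTheory.Lp.norm_rpow_eq_integral {S E : Type*} [MeasurableSpace S] {μ : Measure S}
    [NormedAddCommGroup E] {p : ℝ≥0∞} (hp : p ≠ 0) (hp' : p ≠ ⊤) (f : Lp E p μ) :
    ‖f‖ ^ p.toReal = ∫ s, ‖f s‖ ^ p.toReal ∂μ := by
  have h0 : 0 ≤ ∫ s, ‖f s‖ ^ p.toReal ∂μ :=
    integral_nonneg fun s => Real.rpow_nonneg (norm_nonneg _) _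
  have hq : p.toReal ≠ 0 := (ENNReal.toReal_pos hp hp').ne'
  rw [Lp.norm_def, (Lp.memLp f).eLpNorm_eq_integral_rpow_norm hp hp',
    ENNReal.toReal_ofReal (Real.rpow_nonneg h0 _),
    Real.rpow_inv_rpow h0 hq]

/-- Nonnegative integrable functions whose integrals tend to zero converge to zero almost
everywhere along a subsequence. -/
lemma exists_seq_tendsto_ae_zero_of_tendsto_integral {S : Type*} [MeasurableSpace S]
    {μ : Measure S} {F : ℕ → S → ℝ} (hF : ∀ n, Integrable (F n) μ) (h0 : ∀ n, 0 ≤ᵐ[μ] F n)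
    (h : Tendsto (fun n => ∫ s, F n s ∂μ) atTop (nhds 0)) :
    ∃ ns : ℕ → ℕ, StrictMono ns ∧
      ∀ᵐ s ∂μ, Tendsto (fun n => F (ns n) s) atTop (nhds 0) := by
  refine (tendstoInMeasure_of_tendsto_eLpNorm (p := 1) (g := fun _ => (0 : ℝ)) one_ne_zero
    (fun n => (hF n).aestronglyMeasurable) aestronglyMeasurable_const ?_).exists_seq_tendsto_ae
  have hn : ∀ n, eLpNorm (F n - fun _ => (0 : ℝ)) 1 μ = ENNReal.ofReal (∫ s, F n s ∂μ) := by
    intro n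
    rw [show (F n - fun _ => (0 : ℝ)) = F n from sub_zero _, eLpNorm_one_eq_lintegral_enorm,
      ← ofReal_integral_norm_eq_lintegral_enorm (hF n)]
    congr 1
    refine integral_congr_ae ?_
    filter_upwards [h0 n] with s hs
    exact Real.norm_of_nonneg hs
  simp_rw [hn]
  simpa using ENNReal.tendsto_ofReal h

/-- If `1 < p < ∞` and `X` is a midpoint locally uniformly convex real Banach space, then the
Lebesgue–Bochner space `L^p(μ, X)` is midpoint locally uniformly convex. -/
theorem Lp_midpointLocallyUniformlyConvex {S : Type*} [MeasurableSpace S] (μ : Measure S)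
    (p : ℝ≥0∞) [Fact (1 ≤ p)] (hp : 1 < p) (hp' : p ≠ ⊤)
    (X : Type*) [NormedAddCommGroup X] [NormedSpace ℝ X] [CompleteSpace X]
    (hX : MidpointLocallyUniformlyConvex X) :
    MidpointLocallyUniformlyConvex (Lp X p μ) := by
  intro f fs hadd hsub
  refine tendsto_of_subseq_tendsto fun ns hns => ?_
  have hp0 : p ≠ 0 := (zero_lt_one.trans hp).ne'
  set q := p.toReal
  have hq : 1 < q := by
    simpa using (ENNReal.toReal_lt_toReal ENNReal.one_ne_top hp').2 hp
  have hq0 : 0 < q := zero_lt_one.trans hq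
  have hint : ∀ g : Lp X p μ, Integrable (fun s => ‖g s‖ ^ q) μ := fun g =>
    (Lp.memLp g).integrable_norm_rpow hp0 hp'
  have hnorm : ∀ g : Lp X p μ, ‖g‖ ^ q = ∫ s, ‖g s‖ ^ q ∂μ := Lp.norm_rpow_eq_integral hp0 hp'
  let F : ℕ → S → ℝ := fun n s =>
    (‖(fs (ns n) + f : Lp X p μ) s‖ ^ q + ‖(fs (ns n) - f : Lp X p μ) s‖ ^ q) / 2 - ‖f s‖ ^ q
  have hFint : ∀ n, Integrable (F n) μ := fun n =>
    (((hint _).add (hint _)).div_const 2).sub (hint f)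
  have hFlim : Tendsto (fun n => ∫ s, F n s ∂μ) atTop (nhds 0) := by
    have heq : ∀ n, ∫ s, F n s ∂μ =
        (‖fs (ns n) + f‖ ^ q + ‖fs (ns n) - f‖ ^ q) / 2 - ‖f‖ ^ q := by
      intro n
      rw [hnorm, hnorm, hnorm, ← integral_add (hint _) (hint _), ← integral_div]
      exact integral_sub (((hint _).add (hint _)).div_const 2) (hint f)
    simp_rw [heq]
    have := ((((hadd.comp hns).rpow_const (Or.inr hq0.le)).add
      ((hsub.comp hns).rpow_const (Or.inr hq0.le))).div_const 2).sub_const (‖f‖ ^ q)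
    simpa using this
  have hcoe : ∀ n, ∀ᵐ s ∂μ,
      F n s = (‖fs (ns n) s + f s‖ ^ q + ‖fs (ns n) s - f s‖ ^ q) / 2 - ‖f s‖ ^ q := by
    intro n
    filter_upwards [Lp.coeFn_add (fs (ns n)) f, Lp.coeFn_sub (fs (ns n)) f] with s h1 h2
    simp only [F, h1, h2, Pi.add_apply, Pi.sub_apply]
  have hF0 : ∀ n, 0 ≤ᵐ[μ] F n := by
    intro n
    filter_upwards [hcoe n] with s hs
    rw [hs]
    exact sub_nonneg.2 (rpow_le_avg_rpow hq.le (norm_nonneg _) (norm_nonneg _) (norm_nonneg _)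
      (norm_le_avg_norm_add_norm_sub _ _).1)
  obtain ⟨ms, hms, hae⟩ := exists_seq_tendsto_ae_zero_of_tendsto_integral hFint hF0 hFlim
  refine ⟨ms, ?_⟩
  have hptw : ∀ᵐ s ∂μ, Tendsto (fun n => ‖fs (ns (ms n)) s‖) atTop (nhds 0) := by
    filter_upwards [hae, ae_all_iff.2 hcoe] with s hs hc
    simp_rw [hc] at hs
    have hs' := hs.add_const (‖f s‖ ^ q)
    simp only [sub_add_cancel, zero_add] at hs'
    obtain ⟨h1, h2⟩ := tendsto_of_tendsto_avg_rpow hq (norm_nonneg (f s))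
      (fun n => norm_nonneg _) (fun n => norm_nonneg _)
      (fun n => (norm_le_avg_norm_add_norm_sub (f s) (fs (ns (ms n)) s)).1) hs'
    exact hX (f s) _ h1 h2
  have hmin : Tendsto (fun n => ∫ s, min (‖fs (ns (ms n)) s‖ ^ q) (‖f s‖ ^ q) ∂μ) atTop
      (nhds 0) := by
    have hdom := tendsto_integral_of_dominated_convergence (μ := μ)
      (F := fun n s => min (‖fs (ns (ms n)) s‖ ^ q) (‖f s‖ ^ q)) (f := fun _ => (0 : ℝ))
      (fun s => ‖f s‖ ^ q)
      (fun n => ((hint _).inf (hint f)).aestronglyMeasurable) (hint f)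
      (fun n => Eventually.of_forall fun s => by
        rw [Real.norm_of_nonneg (by positivity)]
        exact min_le_right _ _)
      (by
        filter_upwards [hptw] with s hs
        have h := (hs.rpow_const (p := q) (Or.inr hq0.le)).min
          (tendsto_const_nhds (x := ‖f s‖ ^ q))
        rwa [Real.zero_rpow hq0.ne', min_eq_left (by positivity)] at h)
    simpa using hdom
  have hpow : Tendsto (fun n => ‖fs (ns (ms n))‖ ^ q) atTop (nhds 0) := by
    have hsum := hmin.add (hFlim.comp hms.tendsto_atTop)
    rw [add_zero] at hsum
    refine squeeze_zero (fun n => by positivity) (fun n => ?_) hsum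
    rw [hnorm, Function.comp_apply]
    refine le_of_le_of_eq ?_ (integral_add ((hint _).inf (hint f)) (hFint _))
    refine integral_mono_ae (hint _) (((hint _).inf (hint f)).add (hFint _)) ?_
    filter_upwards [hcoe (ms n), hF0 (ms n)] with s hs h0
    have hle := rpow_le_avg_rpow hq.le (norm_nonneg _) (norm_nonneg _) (norm_nonneg _)
      (norm_le_avg_norm_add_norm_sub (f s) (fs (ns (ms n)) s)).2
    simp only [Pi.zero_apply] at h0
    change _ ≤ min _ _ + F (ms n) s
    rcases min_cases (‖fs (ns (ms n)) s‖ ^ q) (‖f s‖ ^ q) with h | h <;> rw [h.1] <;> linarith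
  have hroot := hpow.rpow_const (p := q⁻¹) (Or.inr (inv_nonneg.2 hq0.le))
  simpa [Real.rpow_rpow_inv (norm_nonneg _) hq0.ne', Real.zero_rpow (inv_ne_zero hq0.ne')]
    using hroot
end

section
/- Let 1 < p < ∞ and let (X_i)_{i ∈ ι} be a family of real Banach spaces. Suppose that for every ε ∈ (0, 2] one has inf_{i ∈ ι} δ_{X_i}(ε) > 0, where δ_{X_i} denotes the modulus of convexity of X_i. Then the ℓ^p-direct sum lp X p is uniformly convex. -/
open scoped ENNReal

/-- The modulus of convexity of a normed space:
`δ_X(ε) = inf { 1 − ‖x + y‖/2 : x, y ∈ B_X, ‖x − y‖ ≥ ε }`. -/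
noncomputable def modulusOfConvexity (X : Type*) [NormedAddCommGroup X] (ε : ℝ) : ℝ :=
  sInf {d : ℝ | ∃ x y : X, ‖x‖ ≤ 1 ∧ ‖y‖ ≤ 1 ∧ ε ≤ ‖x - y‖ ∧ d = 1 - ‖x + y‖ / 2}

theorem half_norm_add_le_one_sub_modulusOfConvexity {E : Type*} [NormedAddCommGroup E] {ε : ℝ}
    {x y : E} (hx : ‖x‖ ≤ 1) (hy : ‖y‖ ≤ 1) (hxy : ε ≤ ‖x - y‖) :
    ‖x + y‖ / 2 ≤ 1 - modulusOfConvexity E ε := by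
  have h : modulusOfConvexity E ε ≤ 1 - ‖x + y‖ / 2 := by
    refine csInf_le ⟨0, ?_⟩ ⟨x, y, hx, hy, hxy, rfl⟩
    rintro _ ⟨u, v, hu, hv, -, rfl⟩
    linarith [norm_add_le u v]
  linarith

theorem half_norm_add_le_mul_one_sub_modulusOfConvexity {E : Type*} [NormedAddCommGroup E]
    [NormedSpace ℝ E] {ε r : ℝ} {x y : E} (hr : 0 < r) (hx : ‖x‖ ≤ r) (hy : ‖y‖ ≤ r)
    (hxy : r * ε ≤ ‖x - y‖) : ‖x + y‖ / 2 ≤ r * (1 - modulusOfConvexity E ε) := by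
  have hscale (z : E) : ‖r⁻¹ • z‖ = ‖z‖ / r := by
    rw [norm_smul, norm_inv, Real.norm_of_nonneg hr.le, inv_mul_eq_div]
  have h := half_norm_add_le_one_sub_modulusOfConvexity (ε := ε) (x := r⁻¹ • x) (y := r⁻¹ • y)
    (by rwa [hscale, div_le_one hr]) (by rwa [hscale, div_le_one hr])
    (by rwa [← smul_sub, hscale, le_div_iff₀' hr])
  rwa [← smul_add, hscale, div_right_comm, div_le_iff₀' hr] at h

theorem half_add_rpow_le {p a b : ℝ} (hp : 1 ≤ p) (ha : 0 ≤ a) (hb : 0 ≤ b) :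
    ((a + b) / 2) ^ p ≤ (a ^ p + b ^ p) / 2 := by
  have h := (convexOn_rpow hp).2 (Set.mem_Ici.2 ha) (Set.mem_Ici.2 hb)
    (half_pos one_pos).le (half_pos one_pos).le (add_halves 1)
  simp only [smul_eq_mul] at h
  rw [← mul_add, ← mul_add, one_div_mul_eq_div, one_div_mul_eq_div] at h
  exact h

/-- A quantitative form of the strict convexity of `t ↦ t ^ p`, uniform up to the point `t = 1`. -/
theorem exists_rpow_add_le_half_one_add_rpow {p c : ℝ} (hp : 1 < p) (hc : 0 < c) :
    ∃ d > 0, ∀ t m : ℝ, 0 ≤ t → t ≤ 1 → 0 ≤ m → m ≤ (1 + t) / 2 → m ≤ 1 - c →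
      m ^ p + d ≤ (1 + t ^ p) / 2 := by
  have hp0 : 0 < p := by linarith
  let f : ℝ → ℝ := fun t ↦ (1 + t ^ p) / 2 - (min (max (1 - c) 0) ((1 + t) / 2)) ^ p
  have hf : Continuous f := by
    have h : Continuous fun t : ℝ ↦ t ^ p := Real.continuous_rpow_const hp0.le
    exact ((continuous_const.add h).div_const 2).sub (h.comp (by fun_prop))
  obtain ⟨s, ⟨hs0, hs1⟩, hs⟩ := (isCompact_Icc (a := (0 : ℝ)) (b := 1)).exists_isMinOn
    ⟨0, by simp⟩ hf.continuousOn
  refine ⟨f s, ?_, fun t m ht0 ht1 hm0 hmt hmc ↦ ?_⟩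
  · have hmin : 0 ≤ min (max (1 - c) 0) ((1 + s) / 2) := le_min (le_max_right _ _) (by linarith)
    rcases hs1.lt_or_eq with hs1 | rfl
    · have h := (strictConvexOn_rpow hp).2 (Set.mem_Ici.2 zero_le_one) (Set.mem_Ici.2 hs0) hs1.ne'
        (half_pos one_pos) (half_pos one_pos) (add_halves 1)
      simp only [smul_eq_mul, Real.one_rpow] at h
      have h' := Real.rpow_le_rpow hmin (min_le_right _ _) hp0.le
      have e : (1 / 2 * 1 + 1 / 2 * s : ℝ) = (1 + s) / 2 := by ring
      rw [e] at h
      simp only [f]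
      linarith
    · have h := Real.rpow_lt_one hmin
        ((min_le_left _ _).trans_lt (max_lt (by linarith) one_pos)) hp0
      simp only [f, Real.one_rpow]
      linarith
  · have h : f s ≤ f t := hs ⟨ht0, ht1⟩
    have h' := Real.rpow_le_rpow hm0 (le_min (hmc.trans (le_max_left _ 0)) hmt) hp0.le
    simp only [f] at h ⊢
    linarith

/-- In normed spaces whose moduli of convexity at `ε` are at least `c`, the convexity inequality for
`‖·‖ ^ p` improves by a fixed factor at pairs that are `ε`-separated relative to their size. -/
theorem exists_half_norm_add_rpow_le {p c ε : ℝ} (hp : 1 < p) (hc : 0 < c) :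
    ∃ d > 0, ∀ (E : Type*) [NormedAddCommGroup E] [NormedSpace ℝ E], c ≤ modulusOfConvexity E ε →
      ∀ x y : E, max ‖x‖ ‖y‖ * ε ≤ ‖x - y‖ →
        (‖x + y‖ / 2) ^ p + d * (‖x‖ ^ p + ‖y‖ ^ p) ≤ (‖x‖ ^ p + ‖y‖ ^ p) / 2 := by
  have hp0 : 0 < p := by linarith
  obtain ⟨d, hd, H⟩ := exists_rpow_add_le_half_one_add_rpow hp hc
  refine ⟨d / 2, by positivity, fun E _ _ hE x y hxy ↦ ?_⟩
  wlog hle : ‖y‖ ≤ ‖x‖ generalizing x y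
  · have h := this y x (by rwa [max_comm, norm_sub_rev]) (le_of_not_ge hle)
    rwa [add_comm y x, add_comm (‖y‖ ^ p)] at h
  rw [max_eq_left hle] at hxy
  rcases (norm_nonneg x).eq_or_lt with hx | hx
  · have hx0 : x = 0 := norm_eq_zero.1 hx.symm
    have hy0 : y = 0 := norm_le_zero_iff.1 (hx.symm ▸ hle)
    simp [hx0, hy0, Real.zero_rpow hp0.ne']
  have hE' : ‖x + y‖ / 2 ≤ ‖x‖ * (1 - c) :=
    (half_norm_add_le_mul_one_sub_modulusOfConvexity hx le_rfl hle hxy).trans (by gcongr)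
  have h := H (‖y‖ / ‖x‖) (‖x + y‖ / 2 / ‖x‖) (by positivity) ((div_le_one hx).2 hle)
    (by positivity)
    (by
      rw [div_le_iff₀ hx]
      have e : (1 + ‖y‖ / ‖x‖) / 2 * ‖x‖ = (‖x‖ + ‖y‖) / 2 := by field_simp
      rw [e]
      linarith [norm_add_le x y])
    ((div_le_iff₀' hx).2 hE')
  rw [Real.div_rpow (by positivity) hx.le, Real.div_rpow (norm_nonneg y) hx.le] at h
  have hxp : 0 < ‖x‖ ^ p := Real.rpow_pos_of_pos hx p
  have hyp : ‖y‖ ^ p ≤ ‖x‖ ^ p := Real.rpow_le_rpow (norm_nonneg y) hle hp0.le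
  have h' := mul_le_mul_of_nonneg_right h hxp.le
  have e₁ : ((‖x + y‖ / 2) ^ p / ‖x‖ ^ p + d) * ‖x‖ ^ p = (‖x + y‖ / 2) ^ p + d * ‖x‖ ^ p := by
    field_simp
  have e₂ : (1 + ‖y‖ ^ p / ‖x‖ ^ p) / 2 * ‖x‖ ^ p = (‖x‖ ^ p + ‖y‖ ^ p) / 2 := by field_simp
  rw [e₁, e₂] at h'
  nlinarith

/-- A form of uniform convexity which, being additive in `p`-th powers of norms, passes to
`ℓ^p`-direct sums. -/
theorem exists_half_norm_add_rpow_add_le {ι : Type*} (X : ι → Type*)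
    [∀ i, NormedAddCommGroup (X i)] [∀ i, NormedSpace ℝ (X i)] {p η : ℝ} (hp : 1 < p) (hη : 0 < η)
    (hX : ∀ ε : ℝ, 0 < ε → ε ≤ 2 → ∃ c : ℝ, 0 < c ∧ ∀ i, c ≤ modulusOfConvexity (X i) ε) :
    ∃ k > 0, ∀ i, ∀ x y : X i,
      (‖x + y‖ / 2) ^ p + k * ‖x - y‖ ^ p ≤ (1 / 2 + k * η) * (‖x‖ ^ p + ‖y‖ ^ p) := by
  have hp0 : 0 < p := by linarith
  obtain ⟨c, hc, hcX⟩ := hX (min (η ^ p⁻¹) 2) (by positivity) (min_le_right _ _)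
  obtain ⟨d, hd, H⟩ := exists_half_norm_add_rpow_le (ε := min (η ^ p⁻¹) 2) hp hc
  have h2p : (0 : ℝ) < 2 ^ p := by positivity
  refine ⟨d / 2 ^ p, by positivity, fun i x y ↦ ?_⟩
  have hxp : 0 ≤ ‖x‖ ^ p := by positivity
  have hyp : 0 ≤ ‖y‖ ^ p := by positivity
  have hmax : max ‖x‖ ‖y‖ ^ p ≤ ‖x‖ ^ p + ‖y‖ ^ p := by
    rcases max_choice ‖x‖ ‖y‖ with h | h <;> rw [h] <;> linarith
  have hmax0 : 0 ≤ max ‖x‖ ‖y‖ := by positivity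
  by_cases hxy : η * (‖x‖ ^ p + ‖y‖ ^ p) ≤ ‖x - y‖ ^ p
  · have hsep : max ‖x‖ ‖y‖ * min (η ^ p⁻¹) 2 ≤ ‖x - y‖ := by
      refine (mul_le_mul_of_nonneg_left (min_le_left _ _) hmax0).trans ?_
      rw [← Real.rpow_le_rpow_iff (by positivity) (norm_nonneg _) hp0,
        Real.mul_rpow hmax0 (by positivity), Real.rpow_inv_rpow hη.le hp0.ne']
      nlinarith
    have h := H (X i) (hcX i) x y hsep
    have hsub : ‖x - y‖ ^ p ≤ 2 ^ p * (‖x‖ ^ p + ‖y‖ ^ p) := by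
      calc ‖x - y‖ ^ p ≤ (2 * max ‖x‖ ‖y‖) ^ p := by
            refine Real.rpow_le_rpow (norm_nonneg _) ?_ hp0.le
            linarith [norm_sub_le x y, le_max_left ‖x‖ ‖y‖, le_max_right ‖x‖ ‖y‖]
        _ = 2 ^ p * max ‖x‖ ‖y‖ ^ p := Real.mul_rpow zero_le_two hmax0
        _ ≤ _ := by gcongr
    have hk : d / 2 ^ p * ‖x - y‖ ^ p ≤ d * (‖x‖ ^ p + ‖y‖ ^ p) := by
      calc d / 2 ^ p * ‖x - y‖ ^ p ≤ d / 2 ^ p * (2 ^ p * (‖x‖ ^ p + ‖y‖ ^ p)) := by gcongr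
        _ = _ := by field_simp
    have : 0 ≤ d / 2 ^ p * η * (‖x‖ ^ p + ‖y‖ ^ p) := by positivity
    linarith
  · have hconv : (‖x + y‖ / 2) ^ p ≤ (‖x‖ ^ p + ‖y‖ ^ p) / 2 :=
      (Real.rpow_le_rpow (by positivity) (by linarith [norm_add_le x y]) hp0.le).trans
        (half_add_rpow_le hp.le (norm_nonneg x) (norm_nonneg y))
    have hk : d / 2 ^ p * ‖x - y‖ ^ p ≤ d / 2 ^ p * (η * (‖x‖ ^ p + ‖y‖ ^ p)) := by
      gcongr
      exact (not_le.1 hxy).le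
    linarith

/-- If `1 < p < ∞` and `(X i)` is a family of real Banach spaces whose moduli of convexity
are uniformly bounded below by a positive constant for each `ε ∈ (0, 2]`, then the
`ℓ^p`-direct sum `lp X p` is uniformly convex. -/
theorem lp_uniformConvex {ι : Type*} (X : ι → Type*)
    [∀ i, NormedAddCommGroup (X i)] [∀ i, NormedSpace ℝ (X i)] [∀ i, CompleteSpace (X i)]
    (p : ℝ≥0∞) [Fact (1 ≤ p)] (hp : 1 < p) (hp' : p ≠ ⊤)
    (hX : ∀ ε : ℝ, 0 < ε → ε ≤ 2 → ∃ c : ℝ, 0 < c ∧ ∀ i, c ≤ modulusOfConvexity (X i) ε) :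
    UniformConvexSpace (lp X p) := by
  have hq : 1 < p.toReal := by
    simpa using (ENNReal.toReal_lt_toReal ENNReal.one_ne_top hp').2 hp
  have hq0 : 0 < p.toReal := by linarith
  refine ⟨fun ε hε ↦ ?_⟩
  have hεp : 0 < ε ^ p.toReal := by positivity
  obtain ⟨k, hk, H⟩ := exists_half_norm_add_rpow_add_le X (η := ε ^ p.toReal / 4) hq
    (by positivity) hX
  have hlt : max (1 - k * ε ^ p.toReal / 2) 0 < 1 :=
    max_lt (by linarith [mul_pos hk hεp]) one_pos
  refine ⟨2 - 2 * max (1 - k * ε ^ p.toReal / 2) 0 ^ p.toReal⁻¹, ?_, fun x hx y hy hxy ↦ ?_⟩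
  · linarith [Real.rpow_lt_one (le_max_right _ _) hlt (inv_pos.2 hq0)]
  have hsum (z : lp X p) : HasSum (fun i ↦ ‖z i‖ ^ p.toReal) (‖z‖ ^ p.toReal) :=
    lp.hasSum_norm hq0 z
  have hadd : HasSum (fun i ↦ (‖x i + y i‖ / 2) ^ p.toReal) ((‖x + y‖ / 2) ^ p.toReal) := by
    simpa only [Real.div_rpow (norm_nonneg _) zero_le_two, lp.coeFn_add, Pi.add_apply] using
      (hsum (x + y)).div_const (2 ^ p.toReal)
  have h := hasSum_le (fun i ↦ H i (x i) (y i)) (hadd.add ((hsum (x - y)).mul_left k))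
    (((hsum x).add (hsum y)).mul_left _)
  rw [hx, hy, Real.one_rpow] at h
  have hεxy : k * ε ^ p.toReal ≤ k * ‖x - y‖ ^ p.toReal := by gcongr
  have hle : ‖x + y‖ / 2 ≤ max (1 - k * ε ^ p.toReal / 2) 0 ^ p.toReal⁻¹ := by
    rw [Real.le_rpow_inv_iff_of_pos (by positivity) (le_max_right _ _) hq0]
    exact le_max_of_le_left (by linarith)
  linarith
end

section
/- Let (S, 𝒜, μ) be a σ-finite measure space, let 1 < p < ∞, and let X be a very convex real Banach space. Then the Lebesgue–Bochner space L^p(μ, X) is very convex. -/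
open scoped ENNReal
open Filter MeasureTheory

/-- A Banach space `X` is very convex if whenever `(xₙ)` is a sequence in the unit sphere,
`x` is in the unit sphere, and there is a functional `x*` in the unit sphere of the dual with
`x*(x) = 1` and `x*(xₙ) → 1`, then `(xₙ)` converges weakly to `x`, i.e. `ψ(xₙ) → ψ(x)` for
every continuous linear functional `ψ`. -/
def VeryConvexSpace (X : Type*) [NormedAddCommGroup X] [NormedSpace ℝ X] : Prop :=
  ∀ (xs : ℕ → X), (∀ n, ‖xs n‖ = 1) → ∀ (x : X), ‖x‖ = 1 →
    ∀ (φ : X →L[ℝ] ℝ), ‖φ‖ = 1 → φ x = 1 →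
    Tendsto (fun n => φ (xs n)) atTop (nhds 1) →
    ∀ (ψ : X →L[ℝ] ℝ), Tendsto (fun n => ψ (xs n)) atTop (nhds (ψ x))

/-- A Helly-type extension result: prescribed values `a i` at the points `x i`, bounded on rational
combinations, are attained by a continuous functional with the same bound. -/
theorem exists_dual_of_rat_combination_le {X : Type*} [NormedAddCommGroup X] [NormedSpace ℝ X]
    {K : ℝ} (hK : 0 ≤ K) (x : ℕ → X) (a : ℕ → ℝ)
    (h : ∀ (N : ℕ) (c : Fin N → ℚ),
      |∑ i, (c i : ℝ) * a i| ≤ K * ‖∑ i, (c i : ℝ) • x i‖) :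
    ∃ k : X →L[ℝ] ℝ, ‖k‖ ≤ K ∧ ∀ i, k (x i) = a i := by
  have hreal : ∀ (N : ℕ) (c : Fin N → ℝ), |∑ i, c i * a i| ≤ K * ‖∑ i, c i • x i‖ := by
    intro N c
    have hd : DenseRange (fun c : Fin N → ℚ => fun i => (c i : ℝ)) :=
      DenseRange.piMap (fun _ => Rat.denseRange_cast)
    refine hd.induction_on (p := fun c => |∑ i, c i * a i| ≤ K * ‖∑ i, c i • x i‖) c ?_ (h N)
    exact isClosed_le (by fun_prop) (by fun_prop)
  set L := Finsupp.linearCombination ℝ x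
  set A := Finsupp.linearCombination ℝ a
  have hAL : ∀ d : ℕ →₀ ℝ, |A d| ≤ K * ‖L d‖ := by
    intro d
    obtain ⟨N, hN⟩ : ∃ N, d.support ⊆ Finset.range N := d.support.exists_nat_subset_range
    have h1 : A d = ∑ i : Fin N, d i * a i := by
      rw [Finsupp.linearCombination_apply, Finsupp.sum_of_support_subset d hN _ (by simp),
        Finset.sum_range]
      rfl
    have h2 : L d = ∑ i : Fin N, d i • x i := by
      rw [Finsupp.linearCombination_apply, Finsupp.sum_of_support_subset d hN _ (by simp),
        Finset.sum_range]
    rw [h1, h2]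
    exact hreal N fun i => d i
  obtain ⟨s, hs⟩ := L.rangeRestrict.exists_rightInverse_of_surjective L.range_rangeRestrict
  have hs' : ∀ v : LinearMap.range L, L (s v) = v := fun v =>
    congrArg Subtype.val (LinearMap.congr_fun hs v)
  let g : StrongDual ℝ (LinearMap.range L) :=
    (A ∘ₗ s).mkContinuous K fun v => by
      simpa [hs'] using hAL (s v)
  obtain ⟨k, hk, hk'⟩ := exists_extension_norm_eq (LinearMap.range L) g
  refine ⟨k, hk' ▸ LinearMap.mkContinuous_norm_le _ hK _, fun i => ?_⟩
  have hi : L (Finsupp.single i 1) = x i := by simp [L]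
  have hAi : A (Finsupp.single i 1) = a i := by simp [A]
  have hmem : x i ∈ LinearMap.range L := ⟨_, hi⟩
  have h3 := hAL (s ⟨x i, hmem⟩ - Finsupp.single i 1)
  rw [map_sub, map_sub, hs', hi, hAi, sub_self, norm_zero, mul_zero] at h3
  calc k (x i) = g ⟨x i, hmem⟩ := hk ⟨x i, hmem⟩
    _ = A (s ⟨x i, hmem⟩) := rfl
    _ = a i := sub_eq_zero.1 (abs_eq_zero.1 (le_antisymm h3 (abs_nonneg _)))

/-- The gap in Young's inequality `a ^ (P - 1) * b ≤ a ^ P * (1 - 1 / P) + b ^ P / P`. -/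
noncomputable def youngGap (P a b : ℝ) : ℝ := a ^ P * (1 - P⁻¹) + b ^ P * P⁻¹ - a ^ (P - 1) * b

theorem rpow_sub_one_mul_self {P a : ℝ} (hP : 1 < P) (ha : 0 ≤ a) : a ^ (P - 1) * a = a ^ P := by
  rcases ha.eq_or_lt with rfl | ha
  · rw [mul_zero, Real.zero_rpow (by linarith)]
  · rw [Real.rpow_sub_one ha.ne', div_mul_cancel₀ _ ha.ne']

theorem youngGap_self {P a : ℝ} (hP : 1 < P) (ha : 0 ≤ a) : youngGap P a a = 0 := by
  rw [youngGap, rpow_sub_one_mul_self hP ha]; ring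

theorem youngGap_pos {P a b : ℝ} (hP : 1 < P) (ha : 0 ≤ a) (hb : 0 ≤ b) (hab : b ≠ a) :
    0 < youngGap P a b := by
  have hP0 : 0 < P := by linarith
  rcases ha.eq_or_lt with rfl | ha
  · have hb' : 0 < b := lt_of_le_of_ne hb hab.symm
    rw [youngGap, Real.zero_rpow hP0.ne', Real.zero_rpow (by linarith)]
    have := Real.rpow_pos_of_pos hb' P
    simp only [zero_mul, zero_add, sub_zero]
    positivity
  · have h1 : -1 ≤ b / a - 1 := by have : 0 ≤ b / a := by positivity
                                   linarith
    have h2 : b / a - 1 ≠ 0 := by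
      rw [sub_ne_zero]
      intro h
      exact hab ((div_eq_one_iff_eq ha.ne').1 h)
    have h3 := one_add_mul_self_lt_rpow_one_add h1 h2 hP
    rw [add_sub_cancel, Real.div_rpow hb ha.le] at h3
    have haP := Real.rpow_pos_of_pos ha P
    have h4 : youngGap P a b = P⁻¹ * a ^ P * (b ^ P / a ^ P - (1 + P * (b / a - 1))) := by
      rw [youngGap, Real.rpow_sub_one ha.ne']
      field_simp
      ring
    rw [h4]
    have := sub_pos.2 h3
    positivity

theorem youngGap_nonneg {P a b : ℝ} (hP : 1 < P) (ha : 0 ≤ a) (hb : 0 ≤ b) :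
    0 ≤ youngGap P a b := by
  rcases eq_or_ne b a with rfl | h
  · exact (youngGap_self hP hb).ge
  · exact (youngGap_pos hP ha hb h).le

theorem convexOn_youngGap {P a : ℝ} (hP : 1 < P) :
    ConvexOn ℝ (Set.Ici 0) (youngGap P a) := by
  have h1 := ((convexOn_rpow hP.le).smul (inv_nonneg.2 (by linarith : 0 ≤ P))).add_const
    (a ^ P * (1 - P⁻¹))
  have h2 : ConvexOn ℝ (Set.Ici 0) (fun b : ℝ => -(a ^ (P - 1)) * b) :=
    (LinearMap.convexOn (LinearMap.mul ℝ ℝ (-(a ^ (P - 1)))) (convex_Ici 0))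
  refine (h1.add h2).congr fun b _ => ?_
  simp only [youngGap, Pi.add_apply, smul_eq_mul]
  ring

theorem tendsto_of_youngGap_tendsto_zero {P a : ℝ} (hP : 1 < P) (ha : 0 ≤ a) {b : ℕ → ℝ}
    (hb : ∀ n, 0 ≤ b n) (h : Tendsto (fun n => youngGap P a (b n)) atTop (nhds 0)) :
    Tendsto b atTop (nhds a) := by
  have key : ∀ c, 0 ≤ c → c ≠ a → ∀ᶠ n in atTop, c ∉ segment ℝ a (b n) := by
    intro c hc hca
    filter_upwards [h.eventually_lt_const (youngGap_pos hP ha hc hca)] with n hn hmem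
    have := (convexOn_youngGap (a := a) hP).le_max_of_mem_segment ha (hb n) hmem
    rw [youngGap_self hP ha, max_eq_right (youngGap_nonneg hP ha (hb n))] at this
    exact absurd this (not_le.2 hn)
  rw [tendsto_order]
  constructor
  · intro c hc
    rcases lt_or_ge c 0 with hc0 | hc0
    · exact Eventually.of_forall fun n => hc0.trans_le (hb n)
    · filter_upwards [key c hc0 hc.ne] with n hn
      by_contra! hcon
      exact hn (by rw [segment_symm, segment_eq_Icc (hcon.trans hc.le)]; exact ⟨hcon, hc.le⟩)
  · intro c hc
    filter_upwards [key c (ha.trans hc.le) hc.ne'] with n hn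
    by_contra! hcon
    exact hn (by rw [segment_eq_Icc (hc.le.trans hcon)]; exact ⟨hc.le, hcon⟩)

/-- A pointwise form of very convexity for vectors that need not be normalized. -/
theorem VeryConvexSpace.tendsto_of_gap {X : Type*} [NormedAddCommGroup X] [NormedSpace ℝ X]
    (hX : VeryConvexSpace X) {P : ℝ} (hP : 1 < P) {x : X} {xs : ℕ → X} {g : X →L[ℝ] ℝ}
    (hg : ‖g‖ ≤ ‖x‖ ^ (P - 1)) (hgx : g x = ‖x‖ ^ P)
    (h : Tendsto (fun n => ‖x‖ ^ P * (1 - P⁻¹) + ‖xs n‖ ^ P * P⁻¹ - g (xs n)) atTop (nhds 0)) :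
    Tendsto (fun n => ‖xs n‖) atTop (nhds ‖x‖) ∧
      ∀ k : X →L[ℝ] ℝ, Tendsto (fun n => k (xs n)) atTop (nhds (k x)) := by
  classical
  have hle : ∀ n, g (xs n) ≤ ‖x‖ ^ (P - 1) * ‖xs n‖ := fun n =>
    (le_abs_self _).trans ((g.le_opNorm _).trans (by gcongr))
  have hnorm : Tendsto (fun n => ‖xs n‖) atTop (nhds ‖x‖) := by
    refine tendsto_of_youngGap_tendsto_zero hP (norm_nonneg _) (fun _ => norm_nonneg _) ?_
    refine squeeze_zero (fun n => youngGap_nonneg hP (norm_nonneg _) (norm_nonneg _))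
      (fun n => ?_) h
    have := hle n
    rw [youngGap]
    linarith
  refine ⟨hnorm, fun k => ?_⟩
  rcases eq_or_ne x 0 with rfl | hx
  · rw [map_zero]
    rw [norm_zero] at hnorm
    exact squeeze_zero_norm (fun n => k.le_opNorm _) (by simpa using hnorm.const_mul ‖k‖)
  have hx0 : 0 < ‖x‖ := norm_pos_iff.2 hx
  set A := ‖x‖ ^ (P - 1) with hA
  have hA0 : 0 < A := Real.rpow_pos_of_pos hx0 _
  have hAx : A * ‖x‖ = ‖x‖ ^ P := rpow_sub_one_mul_self hP hx0.le
  have hgA : ‖g‖ = A := by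
    refine le_antisymm hg ?_
    have h1 := g.le_opNorm x
    rw [hgx, ← hAx, Real.norm_of_nonneg (by positivity)] at h1
    exact le_of_mul_le_mul_right h1 hx0
  have hgxs : Tendsto (fun n => g (xs n)) atTop (nhds (A * ‖x‖)) := by
    have h1 : Tendsto (fun n => ‖x‖ ^ P * (1 - P⁻¹) + ‖xs n‖ ^ P * P⁻¹) atTop
        (nhds (‖x‖ ^ P * (1 - P⁻¹) + ‖x‖ ^ P * P⁻¹)) :=
      tendsto_const_nhds.add ((hnorm.rpow_const (Or.inl hx0.ne')).mul_const _)
    convert h1.sub h using 2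
    · ring
    · rw [hAx]; ring
  let u : X := ‖x‖⁻¹ • x
  let y : ℕ → X := fun n => if xs n = 0 then u else ‖xs n‖⁻¹ • xs n
  have hu : ‖u‖ = 1 := by simp [u, norm_smul, hx0.ne']
  have hy : ∀ n, ‖y n‖ = 1 := by
    intro n
    by_cases hn : xs n = 0
    · simp [y, hn, hu]
    · simp [y, hn, norm_smul]
  have hev : ∀ᶠ n in atTop, xs n ≠ 0 := by
    filter_upwards [hnorm.eventually_const_lt hx0] with n hn
    exact norm_pos_iff.1 hn
  have hy' : ∀ ℓ : X →L[ℝ] ℝ, ∀ᶠ n in atTop, ℓ (y n) = ‖xs n‖⁻¹ * ℓ (xs n) := by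
    intro ℓ
    filter_upwards [hev] with n hn
    simp [y, hn]
  have hinv := hnorm.inv₀ hx0.ne'
  have hlim := hX y hy u hu (A⁻¹ • g)
    (by rw [norm_smul, hgA, Real.norm_of_nonneg (by positivity), inv_mul_cancel₀ hA0.ne'])
    (by
      simp only [u, smul_apply, map_smul, smul_eq_mul, hgx, ← hAx]
      field_simp)
    (by
      have h1 := (hinv.mul hgxs).const_mul A⁻¹
      have h2 : A⁻¹ * (‖x‖⁻¹ * (A * ‖x‖)) = 1 := by field_simp
      rw [h2] at h1
      refine h1.congr' ?_
      filter_upwards [hy' g] with n hn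
      simp [hn]) k
  have h1 := hnorm.mul hlim
  have h2 : ‖x‖ * k u = k x := by
    simp only [u, map_smul, smul_eq_mul]
    field_simp
  rw [h2] at h1
  refine h1.congr' ?_
  filter_upwards [hy' k, hev] with n hn hn0
  have : ‖xs n‖ ≠ 0 := norm_ne_zero_iff.2 hn0
  rw [hn]
  field_simp

section Density

variable {S : Type*} [MeasurableSpace S] {μ : Measure S} {p : ℝ≥0∞}
  {X : Type*} [NormedAddCommGroup X]

open Classical in
/-- Restriction of `h : Lp X p μ` to a measurable set (and `0` on nonmeasurable sets). -/
noncomputable def lpRestrict (h : Lp X p μ) (A : Set S) : Lp X p μ :=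
  if hA : MeasurableSet A then ((Lp.memLp h).indicator hA).toLp _ else 0

theorem coeFn_lpRestrict (h : Lp X p μ) {A : Set S} (hA : MeasurableSet A) :
    lpRestrict h A =ᵐ[μ] A.indicator h := by
  rw [lpRestrict, dif_pos hA]
  exact MemLp.coeFn_toLp _

theorem lpRestrict_of_not_measurableSet (h : Lp X p μ) {A : Set S} (hA : ¬MeasurableSet A) :
    lpRestrict h A = 0 := by
  rw [lpRestrict, dif_neg hA]

theorem lpRestrict_univ (h : Lp X p μ) : lpRestrict h Set.univ = h :=
  Lp.ext ((coeFn_lpRestrict h .univ).trans (by simp))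

theorem lpRestrict_union (h : Lp X p μ) {A B : Set S} (hA : MeasurableSet A)
    (hB : MeasurableSet B) (hAB : Disjoint A B) :
    lpRestrict h (A ∪ B) = lpRestrict h A + lpRestrict h B := by
  refine Lp.ext ?_
  filter_upwards [coeFn_lpRestrict h hA, coeFn_lpRestrict h hB, coeFn_lpRestrict h (hA.union hB),
    Lp.coeFn_add (lpRestrict h A) (lpRestrict h B)] with s h1 h2 h3 h4
  rw [h3, h4, Pi.add_apply, h1, h2, Set.indicator_union_of_disjoint hAB]

theorem lpRestrict_biUnion_finset (h : Lp X p μ) {A : ℕ → Set S} (hA : ∀ i, MeasurableSet (A i))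
    (hd : Pairwise (Function.onFun Disjoint A)) (F : Finset ℕ) :
    lpRestrict h (⋃ i ∈ F, A i) = ∑ i ∈ F, lpRestrict h (A i) := by
  induction F using Finset.induction_on with
  | empty =>
    refine Lp.ext ?_
    filter_upwards [coeFn_lpRestrict h MeasurableSet.empty, Lp.coeFn_zero X p μ] with s h1 h2
    rw [Finset.sum_empty, h2]
    simpa using h1
  | insert a F ha ih =>
    rw [Finset.set_biUnion_insert, Finset.sum_insert ha, ← ih,
      lpRestrict_union h (hA a) (F.measurableSet_biUnion fun i _ => hA i)]
    rw [Set.disjoint_iUnion₂_right]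
    intro i hi
    exact hd fun hai => ha (hai ▸ hi)

theorem lpRestrict_lpRestrict (h : Lp X p μ) {A B : Set S} (hA : MeasurableSet A)
    (hB : MeasurableSet B) : lpRestrict (lpRestrict h B) A = lpRestrict h (A ∩ B) := by
  refine Lp.ext ?_
  filter_upwards [coeFn_lpRestrict (lpRestrict h B) hA, coeFn_lpRestrict h hB,
    coeFn_lpRestrict h (hA.inter hB)] with s h1 h2 h3
  rw [h1, h3, ← Set.indicator_indicator]
  by_cases hs : s ∈ A <;> simp [hs, h2]

theorem lpRestrict_add (h h' : Lp X p μ) (A : Set S) :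
    lpRestrict (h + h') A = lpRestrict h A + lpRestrict h' A := by
  by_cases hA : MeasurableSet A
  · refine Lp.ext ?_
    filter_upwards [coeFn_lpRestrict (h + h') hA, coeFn_lpRestrict h hA, coeFn_lpRestrict h' hA,
      Lp.coeFn_add h h', Lp.coeFn_add (lpRestrict h A) (lpRestrict h' A)] with s h1 h2 h3 h4 h5
    rw [h1, h5, Pi.add_apply, h2, h3]
    by_cases hs : s ∈ A
    · simp only [Set.indicator_of_mem hs]
      exact h4
    · simp [hs]
  · simp [lpRestrict_of_not_measurableSet _ hA]

section

variable [NormedSpace ℝ X]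

theorem lpRestrict_smul (c : ℝ) (h : Lp X p μ) (A : Set S) :
    lpRestrict (c • h) A = c • lpRestrict h A := by
  by_cases hA : MeasurableSet A
  · refine Lp.ext ?_
    filter_upwards [coeFn_lpRestrict (c • h) hA, coeFn_lpRestrict h hA,
      Lp.coeFn_smul c h, Lp.coeFn_smul c (lpRestrict h A)] with s h1 h2 h3 h4
    rw [h1, h4, Pi.smul_apply, h2]
    by_cases hs : s ∈ A <;> simp [hs, h3]
  · simp [lpRestrict_of_not_measurableSet _ hA]

theorem coeFn_sum_smul {ι : Type*} (F : ι → Lp X p μ) (c : ι → ℝ) (u : Finset ι) :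
    ⇑(∑ i ∈ u, c i • F i : Lp X p μ) =ᵐ[μ] fun s => ∑ i ∈ u, c i • F i s := by
  classical
  induction u using Finset.induction_on with
  | empty =>
    filter_upwards [Lp.coeFn_zero X p μ] with s hs
    simpa using hs
  | insert a u ha ih =>
    simp only [Finset.sum_insert ha]
    filter_upwards [ih, Lp.coeFn_add (c a • F a) (∑ i ∈ u, c i • F i), Lp.coeFn_smul (c a) (F a)]
      with s h1 h2 h3
    rw [h2, Pi.add_apply, h1, h3, Pi.smul_apply]

end

variable [Fact (1 ≤ p)]

theorem integrable_norm_rpow_Lp (hp' : p ≠ ⊤) (h : Lp X p μ) :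
    Integrable (fun s => ‖h s‖ ^ p.toReal) μ :=
  (Lp.memLp h).integrable_norm_rpow (zero_lt_one.trans_le Fact.out).ne' hp'

theorem Lp_norm_rpow_eq_integral (hp' : p ≠ ⊤) (h : Lp X p μ) :
    ‖h‖ ^ p.toReal = ∫ s, ‖h s‖ ^ p.toReal ∂μ := by
  have hp0 : p ≠ 0 := (zero_lt_one.trans_le Fact.out).ne'
  rw [Lp.norm_def, toReal_eLpNorm (Lp.aestronglyMeasurable h),
    lpNorm_eq_integral_norm_rpow_toReal hp0 hp' (Lp.aestronglyMeasurable h),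
    Real.rpow_inv_rpow (integral_nonneg fun _ => by positivity) (ENNReal.toReal_ne_zero.2 ⟨hp0, hp'⟩)]

theorem norm_lpRestrict_rpow (hp' : p ≠ ⊤) (h : Lp X p μ) {A : Set S} (hA : MeasurableSet A) :
    ‖lpRestrict h A‖ ^ p.toReal = ∫ s in A, ‖h s‖ ^ p.toReal ∂μ := by
  have hp0 : p ≠ 0 := (zero_lt_one.trans_le Fact.out).ne'
  rw [Lp_norm_rpow_eq_integral hp', ← integral_indicator hA]
  refine integral_congr_ae ?_
  filter_upwards [coeFn_lpRestrict h hA] with s hs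
  rw [hs]
  by_cases hs : s ∈ A
  · simp [hs]
  · simp [hs, Real.zero_rpow (ENNReal.toReal_ne_zero.2 ⟨hp0, hp'⟩)]

theorem hasSum_lpRestrict (hp' : p ≠ ⊤) (h : Lp X p μ) {A : ℕ → Set S}
    (hA : ∀ i, MeasurableSet (A i)) (hd : Pairwise (Function.onFun Disjoint A)) :
    HasSum (fun i => lpRestrict h (A i)) (lpRestrict h (⋃ i, A i)) := by
  have hP : 0 < p.toReal := ENNReal.toReal_pos (zero_lt_one.trans_le Fact.out).ne' hp'
  have hint := integrable_norm_rpow_Lp hp' h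
  have hsum := hasSum_integral_iUnion hA hd hint.integrableOn
  have key : ∀ F : Finset ℕ, ‖(∑ i ∈ F, lpRestrict h (A i)) - lpRestrict h (⋃ i, A i)‖ =
      ((∫ s in ⋃ i, A i, ‖h s‖ ^ p.toReal ∂μ) -
        ∑ i ∈ F, ∫ s in A i, ‖h s‖ ^ p.toReal ∂μ) ^ p.toReal⁻¹ := by
    intro F
    have hF := F.measurableSet_biUnion fun i _ => hA i
    have hU := MeasurableSet.iUnion hA
    have hsub : (⋃ i ∈ F, A i) ⊆ ⋃ i, A i := Set.iUnion₂_subset fun i _ => Set.subset_iUnion A i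
    have hdis : Disjoint (⋃ i ∈ F, A i) ((⋃ i, A i) \ ⋃ i ∈ F, A i) := Set.disjoint_sdiff_right
    have h1 := lpRestrict_union h hF (hU.diff hF) hdis
    rw [Set.union_sdiff_cancel hsub] at h1
    have h2 := norm_lpRestrict_rpow hp' h (hU.diff hF)
    rw [setIntegral_sdiff hF hint.integrableOn hsub,
      integral_biUnion_finset F (fun i _ => hA i) (fun i _ j _ hij => hd hij)
        (fun i _ => hint.integrableOn)] at h2
    rw [← h2, Real.rpow_rpow_inv (norm_nonneg _) hP.ne', norm_sub_rev, h1,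
      ← lpRestrict_biUnion_finset h hA hd, add_sub_cancel_left]
  rw [HasSum, SummationFilter.unconditional_filter, tendsto_iff_norm_sub_tendsto_zero]
  simp_rw [key]
  have h0 := (hsum.const_sub (∫ s in ⋃ i, A i, ‖h s‖ ^ p.toReal ∂μ)).rpow_const
    (p := p.toReal⁻¹) (Or.inr (by positivity))
  simpa [Real.zero_rpow (inv_ne_zero hP.ne')] using h0

theorem rpow_sub_one_mul_le {P a b : ℝ} (hP : 1 < P) (ha : 0 ≤ a) (hb : 0 ≤ b) :
    a ^ (P - 1) * b ≤ a ^ P * (1 - P⁻¹) + b ^ P * P⁻¹ := by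
  have := youngGap_nonneg hP ha hb
  rw [youngGap] at this
  linarith

theorem integrable_norm_rpow_sub_one_mul_norm (hp : 1 < p) (hp' : p ≠ ⊤) (f h : Lp X p μ) :
    Integrable (fun s => ‖f s‖ ^ (p.toReal - 1) * ‖h s‖) μ := by
  have hP : 1 < p.toReal := by simpa using (ENNReal.toReal_lt_toReal ENNReal.one_ne_top hp').2 hp
  refine (((integrable_norm_rpow_Lp hp' f).mul_const (1 - p.toReal⁻¹)).add
    ((integrable_norm_rpow_Lp hp' h).mul_const p.toReal⁻¹)).mono' ?_ ?_
  · exact (((Lp.aestronglyMeasurable f).norm.aemeasurable.pow_const _).mul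
      (Lp.aestronglyMeasurable h).norm.aemeasurable).aestronglyMeasurable
  · refine Eventually.of_forall fun s => ?_
    rw [Real.norm_of_nonneg (by positivity)]
    exact rpow_sub_one_mul_le hP (norm_nonneg _) (norm_nonneg _)

variable [NormedSpace ℝ X]

/-- `θ` is the density of the set function `A ↦ ψ (1_A h)`. -/
structure IsDensity (ψ : Lp X p μ →L[ℝ] ℝ) (h : Lp X p μ) (θ : S → ℝ) : Prop where
  measurable : Measurable θ
  integrable : Integrable θ μ
  apply_eq : ∀ A, MeasurableSet A → ψ (lpRestrict h A) = ∫ s in A, θ s ∂μ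

theorem exists_isDensity [SigmaFinite μ] (hp' : p ≠ ⊤) (ψ : Lp X p μ →L[ℝ] ℝ) (h : Lp X p μ) :
    ∃ θ, IsDensity ψ h θ := by
  have hp0 : p ≠ 0 := (zero_lt_one.trans_le Fact.out).ne'
  have hnull : ∀ A, MeasurableSet A → μ A = 0 → lpRestrict h A = 0 := by
    intro A hA hA0
    refine Lp.ext ?_
    filter_upwards [coeFn_lpRestrict h hA, Lp.coeFn_zero X p μ, measure_eq_zero_iff_ae_notMem.1 hA0]
      with s h1 h2 h3
    rw [h1, h2]
    simp [h3]
  let m : SignedMeasure S :=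
    { measureOf' := fun A => ψ (lpRestrict h A)
      empty' := by simp [hnull ∅ .empty measure_empty]
      not_measurable' := fun A hA => by simp [lpRestrict_of_not_measurableSet h hA]
      m_iUnion' := fun A hA hd => (hasSum_lpRestrict hp' h hA hd).mapL ψ }
  have hm : m ≪ᵥ μ.toENNRealVectorMeasure := by
    intro A hA0
    by_cases hA : MeasurableSet A
    · rw [Measure.toENNRealVectorMeasure_apply_measurable hA] at hA0
      change ψ (lpRestrict h A) = 0
      rw [hnull A hA hA0, map_zero]
    · exact m.not_measurable hA
  have hi := SignedMeasure.integrable_rnDeriv m μ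
  refine ⟨m.rnDeriv μ, SignedMeasure.measurable_rnDeriv m μ, hi, fun A hA => ?_⟩
  have := withDensityᵥ_apply hi hA
  rw [SignedMeasure.withDensityᵥ_rnDeriv_eq m μ hm] at this
  exact this

namespace IsDensity

variable {ψ : Lp X p μ →L[ℝ] ℝ} {h h' : Lp X p μ} {θ θ' : S → ℝ}

theorem apply_self (H : IsDensity ψ h θ) : ψ h = ∫ s, θ s ∂μ := by
  simpa [lpRestrict_univ] using H.apply_eq Set.univ .univ

theorem add (H : IsDensity ψ h θ) (H' : IsDensity ψ h' θ') :
    IsDensity ψ (h + h') (fun s => θ s + θ' s) where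
  measurable := H.measurable.add H'.measurable
  integrable := H.integrable.add H'.integrable
  apply_eq A hA := by
    rw [lpRestrict_add, map_add, H.apply_eq A hA, H'.apply_eq A hA,
      integral_add H.integrable.integrableOn H'.integrable.integrableOn]

theorem smul (H : IsDensity ψ h θ) (c : ℝ) : IsDensity ψ (c • h) (fun s => c * θ s) where
  measurable := H.measurable.const_mul c
  integrable := H.integrable.const_mul c
  apply_eq A hA := by
    rw [lpRestrict_smul, map_smul, H.apply_eq A hA, integral_const_mul, smul_eq_mul]

theorem zero (ψ : Lp X p μ →L[ℝ] ℝ) : IsDensity ψ 0 (fun _ => 0) where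
  measurable := measurable_const
  integrable := integrable_zero _ _ _
  apply_eq A _ := by
    have : lpRestrict (0 : Lp X p μ) A = 0 := by simpa using lpRestrict_smul 0 (0 : Lp X p μ) A
    simp [this]

theorem sum {ι : Type*} {F : ι → Lp X p μ} {t : ι → S → ℝ} (H : ∀ i, IsDensity ψ (F i) (t i))
    (c : ι → ℝ) (u : Finset ι) :
    IsDensity ψ (∑ i ∈ u, c i • F i) (fun s => ∑ i ∈ u, c i * t i s) := by
  classical
  induction u using Finset.induction_on with
  | empty =>
    simpa using zero ψ
  | insert a u ha ih =>
    simp only [Finset.sum_insert ha]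
    exact ((H a).smul (c a)).add ih

theorem restrict (H : IsDensity ψ h θ) {B : Set S} (hB : MeasurableSet B) :
    IsDensity ψ (lpRestrict h B) (B.indicator θ) where
  measurable := H.measurable.indicator hB
  integrable := H.integrable.indicator hB
  apply_eq A hA := by
    rw [lpRestrict_lpRestrict h hA hB, H.apply_eq _ (hA.inter hB), setIntegral_indicator hB]

end IsDensity

/-- A functional norming the unit vector `f` is dominated by the subdifferential of the norm
of `L^p` at `‖f ·‖`. -/
theorem apply_le_integral_of_norming (hp : 1 < p) (hp' : p ≠ ⊤) {φ : Lp X p μ →L[ℝ] ℝ}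
    (hφ : ‖φ‖ = 1) {f : Lp X p μ} (hf : ‖f‖ = 1) (hφf : φ f = 1) (h : Lp X p μ) :
    φ h ≤ ∫ s, ‖f s‖ ^ (p.toReal - 1) * ‖h s‖ ∂μ := by
  have hP : 1 < p.toReal := by simpa using (ENNReal.toReal_lt_toReal ENNReal.one_ne_top hp').2 hp
  set P := p.toReal with hPdef
  have hP0 : 0 < P := by linarith
  rcases lt_or_ge (φ h) 0 with hneg | hpos
  · exact hneg.le.trans (integral_nonneg fun s => by positivity)
  let q : ℕ → S → ℝ := fun n s =>
    ((‖f s‖ + (1 / ((n : ℝ) + 1)) * ‖h s‖) ^ P - ‖f s‖ ^ P) / (1 / ((n : ℝ) + 1)) * P⁻¹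
  have hint : ∀ t : ℝ, 0 ≤ t → Integrable (fun s => (‖f s‖ + t * ‖h s‖) ^ P) μ := by
    intro t ht
    have h1 := ((Lp.memLp f).norm.add ((Lp.memLp h).norm.const_mul t)).integrable_norm_rpow
      (zero_lt_one.trans hp).ne' hp'
    refine h1.congr (Eventually.of_forall fun s => ?_)
    simp only [Pi.add_apply]
    rw [Real.norm_of_nonneg (by positivity)]
  have hdom : Integrable (fun s => (‖f s‖ + ‖h s‖) ^ P * P⁻¹) μ := by
    simpa using (hint 1 zero_le_one).mul_const P⁻¹
  have hqint : ∀ n, Integrable (q n) μ := fun n =>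
    (((hint _ (by positivity)).sub (integrable_norm_rpow_Lp hp' f)).div_const _).mul_const _
  have hlower : ∀ n, φ h ≤ ∫ s, q n s ∂μ := by
    intro n
    set t : ℝ := 1 / ((n : ℝ) + 1) with ht
    have ht0 : 0 < t := by positivity
    have h1 : 1 + P * (t * φ h) ≤ (1 + t * φ h) ^ P :=
      one_add_mul_self_le_rpow_one_add (by have := mul_nonneg ht0.le hpos; linarith) hP.le
    have h2 : 1 + t * φ h ≤ ‖f + t • h‖ := by
      have := (le_abs_self _).trans (φ.le_opNorm (f + t • h))
      rwa [hφ, one_mul, map_add, map_smul, hφf, smul_eq_mul] at this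
    have h3 : (1 + t * φ h) ^ P ≤ ∫ s, (‖f s‖ + t * ‖h s‖) ^ P ∂μ := by
      refine (Real.rpow_le_rpow (by positivity) h2 hP0.le).trans ?_
      rw [Lp_norm_rpow_eq_integral hp']
      refine integral_mono_ae (integrable_norm_rpow_Lp hp' _) (hint t ht0.le) ?_
      filter_upwards [Lp.coeFn_add f (t • h), Lp.coeFn_smul t h] with s hs1 hs2
      rw [hs1, Pi.add_apply, hs2, Pi.smul_apply]
      gcongr
      refine (norm_add_le _ _).trans ?_
      rw [norm_smul, Real.norm_of_nonneg ht0.le]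
    have h4 : ∫ s, ‖f s‖ ^ P ∂μ = 1 := by
      rw [← Lp_norm_rpow_eq_integral hp', hf, Real.one_rpow]
    have h5 : ∫ s, q n s ∂μ = ((∫ s, (‖f s‖ + t * ‖h s‖) ^ P ∂μ) - 1) / t * P⁻¹ := by
      simp only [q, ← ht]
      rw [integral_mul_const, integral_div, integral_sub (hint t ht0.le) (integrable_norm_rpow_Lp hp' f),
        h4]
    rw [h5, ← div_eq_mul_inv, le_div_iff₀ hP0, le_div_iff₀ ht0]
    linarith
  refine ge_of_tendsto (f := fun n => ∫ s, q n s ∂μ) (x := atTop) ?_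
    (Eventually.of_forall hlower)
  refine tendsto_integral_of_dominated_convergence _ (fun n => (hqint n).aestronglyMeasurable)
    hdom (fun n => Eventually.of_forall fun s => ?_) (Eventually.of_forall fun s => ?_)
  · set t : ℝ := 1 / ((n : ℝ) + 1) with ht
    have ht0 : 0 < t := by positivity
    have ht1 : t ≤ 1 := by
      rw [ht, div_le_one (by positivity)]
      have : (0 : ℝ) ≤ n := n.cast_nonneg
      linarith
    have ha := norm_nonneg (f s)
    have hb := norm_nonneg (h s)
    have h1 : ‖f s‖ ^ P ≤ (‖f s‖ + t * ‖h s‖) ^ P :=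
      Real.rpow_le_rpow ha (by have := mul_nonneg ht0.le hb; linarith) hP0.le
    have h2 : (‖f s‖ + t * ‖h s‖) ^ P ≤ (1 - t) * ‖f s‖ ^ P + t * (‖f s‖ + ‖h s‖) ^ P := by
      have := (convexOn_rpow hP.le).2 (Set.mem_Ici.2 ha)
        (Set.mem_Ici.2 (add_nonneg ha hb)) (sub_nonneg.2 ht1) ht0.le (by ring)
      simp only [smul_eq_mul] at this
      rwa [show ‖f s‖ + t * ‖h s‖ = (1 - t) * ‖f s‖ + t * (‖f s‖ + ‖h s‖) by ring]
    have h3 : 0 ≤ ‖f s‖ ^ P := by positivity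
    simp only [q, ← ht]
    rw [Real.norm_of_nonneg (by have := sub_nonneg.2 h1; positivity)]
    gcongr
    rw [div_le_iff₀ ht0]
    nlinarith
  · have hd : HasDerivAt (fun t : ℝ => (‖f s‖ + t * ‖h s‖) ^ P)
        ((1 * ‖h s‖) * P * (‖f s‖ + 0 * ‖h s‖) ^ (P - 1)) 0 :=
      (((hasDerivAt_id (0 : ℝ)).mul_const ‖h s‖).const_add ‖f s‖).rpow_const (Or.inr hP.le)
    rw [hasDerivAt_iff_tendsto_slope_zero] at hd
    have ht : Tendsto (fun n : ℕ => 1 / ((n : ℝ) + 1)) atTop (nhdsWithin 0 {0}ᶜ) := by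
      rw [tendsto_nhdsWithin_iff]
      refine ⟨tendsto_one_div_add_atTop_nhds_zero_nat, Eventually.of_forall fun n => ?_⟩
      have : (0 : ℝ) < 1 / ((n : ℝ) + 1) := by positivity
      exact this.ne'
    convert (hd.comp ht).mul_const P⁻¹ using 2
    · simp [q, div_eq_inv_mul]
    · simp only [zero_mul, add_zero, one_mul]
      field_simp

theorem IsDensity.abs_le_of_norming (hp : 1 < p) (hp' : p ≠ ⊤) {φ : Lp X p μ →L[ℝ] ℝ}
    (hφ : ‖φ‖ = 1) {f : Lp X p μ} (hf : ‖f‖ = 1) (hφf : φ f = 1) {h : Lp X p μ} {θ : S → ℝ}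
    (H : IsDensity φ h θ) : ∀ᵐ s ∂μ, |θ s| ≤ ‖f s‖ ^ (p.toReal - 1) * ‖h s‖ := by
  have key : ∀ {h : Lp X p μ} {θ : S → ℝ}, IsDensity φ h θ →
      ∀ᵐ s ∂μ, θ s ≤ ‖f s‖ ^ (p.toReal - 1) * ‖h s‖ := by
    intro h θ H
    refine ae_le_of_forall_setIntegral_le H.integrable
      (integrable_norm_rpow_sub_one_mul_norm hp hp' f h) fun A hA _ => ?_
    rw [← H.apply_eq A hA]
    refine (apply_le_integral_of_norming hp hp' hφ hf hφf _).trans_eq ?_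
    rw [← integral_indicator hA]
    refine integral_congr_ae ?_
    filter_upwards [coeFn_lpRestrict h hA] with s hs
    rw [hs]
    by_cases hs : s ∈ A <;> simp [hs]
  filter_upwards [key H, key (H.smul (-1)), Lp.coeFn_smul (-1 : ℝ) h] with s h1 h2 h3
  rw [h3, Pi.smul_apply, norm_smul] at h2
  rw [abs_le]
  norm_num at h2
  constructor <;> linarith

theorem exists_integrable_majorant_of_monotone {u : ℕ → S → ℝ} (hu : ∀ n, Integrable (u n) μ)
    (hmono : ∀ s, Monotone fun n => u n s) {C : ℝ} (hC : ∀ n, ∫ s, u n s ∂μ ≤ C) :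
    ∃ M, Integrable M μ ∧ ∀ᵐ s ∂μ, ∀ n, u n s ≤ M s := by
  let v : ℕ → S → ℝ≥0∞ := fun n s => ENNReal.ofReal (u n s - u 0 s)
  have hv : ∀ n, AEMeasurable (v n) μ := fun n =>
    ((hu n).sub (hu 0)).aestronglyMeasurable.aemeasurable.ennreal_ofReal
  have hvle : ∀ n, ∫⁻ s, v n s ∂μ ≤ ENNReal.ofReal (C - ∫ s, u 0 s ∂μ) := by
    intro n
    have h1 := ofReal_integral_eq_lintegral_ofReal ((hu n).sub (hu 0))
      (Eventually.of_forall fun s => sub_nonneg.2 (hmono s n.zero_le))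
    refine h1.symm.trans_le ?_
    refine ENNReal.ofReal_le_ofReal ?_
    rw [integral_sub' (hu n) (hu 0)]
    linarith [hC n]
  have hL : ∫⁻ s, ⨆ n, v n s ∂μ ≠ ⊤ := by
    rw [lintegral_iSup' hv (Eventually.of_forall fun s i j hij =>
      ENNReal.ofReal_le_ofReal (sub_le_sub_right (hmono s hij) _))]
    exact ((iSup_le hvle).trans_lt ENNReal.ofReal_lt_top).ne
  have hmeas : AEMeasurable (fun s => ⨆ n, v n s) μ := AEMeasurable.iSup hv
  refine ⟨fun s => u 0 s + (⨆ n, v n s).toReal,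
    (hu 0).add (integrable_toReal_of_lintegral_ne_top hmeas hL), ?_⟩
  filter_upwards [ae_lt_top' hmeas hL] with s hs n
  have h1 : v n s ≤ ⨆ n, v n s := le_iSup (fun n => v n s) n
  have h2 := (ENNReal.ofReal_le_iff_le_toReal hs.ne).1 h1
  linarith

theorem exists_integrable_majorant_of_density {ψ : Lp X p μ →L[ℝ] ℝ} {f : Lp X p μ}
    {g : ℕ → Lp X p μ} {t : ℕ → S → ℝ} (H : ∀ j, IsDensity ψ (g j) (t j))
    (hg : ∀ j, ∀ᵐ s ∂μ, ‖g j s‖ ≤ ‖f s‖) :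
    ∃ M, Integrable M μ ∧ ∀ᵐ s ∂μ, ∀ j, t j s ≤ M s := by
  have hG : ∀ n, ∃ G : Lp X p μ, (∀ᵐ s ∂μ, ‖G s‖ ≤ ‖f s‖) ∧
      IsDensity ψ G (fun s => partialSups (fun j => t j s) n) := by
    intro n
    induction n with
    | zero => exact ⟨g 0, hg 0, by simpa using H 0⟩
    | succ n ih =>
      obtain ⟨G, hGf, HG⟩ := ih
      let B : Set S := {s | t (n + 1) s < partialSups (fun j => t j s) n}
      have hB : MeasurableSet B := measurableSet_lt (H (n + 1)).measurable HG.measurable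
      refine ⟨lpRestrict G B + lpRestrict (g (n + 1)) Bᶜ, ?_, ?_⟩
      · filter_upwards [hGf, hg (n + 1), coeFn_lpRestrict G hB,
          coeFn_lpRestrict (g (n + 1)) hB.compl,
          Lp.coeFn_add (lpRestrict G B) (lpRestrict (g (n + 1)) Bᶜ)] with s h1 h2 h3 h4 h5
        rw [h5, Pi.add_apply, h3, h4]
        by_cases hs : s ∈ B <;> simp [hs, h1, h2]
      · convert (HG.restrict hB).add ((H (n + 1)).restrict hB.compl) using 2 with s
        rw [partialSups_add_one]
        by_cases hs : s ∈ B
        · simpa [hs] using (show t (n + 1) s < partialSups (fun j => t j s) n from hs).le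
        · simpa [hs] using not_lt.1 (show ¬t (n + 1) s < partialSups (fun j => t j s) n from hs)
  choose G hGf HG using hG
  obtain ⟨M, hM, hle⟩ := exists_integrable_majorant_of_monotone (C := ‖ψ‖ * ‖f‖)
    (fun n => (HG n).integrable) (fun s => (partialSups fun j => t j s).monotone) (fun n => by
      rw [← (HG n).apply_self]
      refine (le_abs_self _).trans ((ψ.le_opNorm _).trans ?_)
      gcongr
      exact Lp.norm_le_norm_of_ae_le (hGf n))
  refine ⟨M, hM, ?_⟩
  filter_upwards [hle] with s hs j
  exact (le_partialSups (fun j => t j s) j).trans (hs j)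

/-- For a countable family of vectors, the densities of `ψ` are controlled by one integrable
function relative to `‖f ·‖`. -/
theorem exists_integrable_bound_of_density {ι : Type*} [Countable ι] [Nonempty ι]
    {ψ : Lp X p μ →L[ℝ] ℝ} (f : Lp X p μ) {F : ι → Lp X p μ} {t : ι → S → ℝ}
    (H : ∀ i, IsDensity ψ (F i) (t i)) :
    ∃ M, Integrable M μ ∧ (∀ s, 0 ≤ M s) ∧
      ∀ᵐ s ∂μ, ∀ i, ∀ r : ℚ, 0 < r → ‖F i s‖ ≤ r * ‖f s‖ → |t i s| ≤ r * M s := by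
  let κ := ι × {r : ℚ // 0 < r}
  have : Nonempty {r : ℚ // 0 < r} := ⟨⟨1, one_pos⟩⟩
  obtain ⟨e, he⟩ := exists_surjective_nat κ
  let B : κ → Set S := fun k => {s | ‖F k.1 s‖ ≤ (k.2 : ℚ) * ‖f s‖}
  have hB : ∀ k, MeasurableSet (B k) := fun k =>
    measurableSet_le (Lp.stronglyMeasurable _).norm.measurable
      ((Lp.stronglyMeasurable _).norm.measurable.const_mul _)
  have hr : ∀ k : κ, (0 : ℝ) < (k.2 : ℚ) := fun k => Rat.cast_pos.2 k.2.2
  have main : ∀ c : ℝ, |c| = 1 → ∃ M, Integrable M μ ∧ ∀ᵐ s ∂μ, ∀ i, ∀ r : ℚ, 0 < r →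
      ‖F i s‖ ≤ r * ‖f s‖ → c * t i s ≤ r * M s := by
    intro c hc
    obtain ⟨M, hM, hle⟩ := exists_integrable_majorant_of_density (f := f)
      (fun j => (((H (e j).1).restrict (hB (e j))).smul (c * (((e j).2 : ℚ) : ℝ)⁻¹))) (fun j => by
        filter_upwards [coeFn_lpRestrict (F (e j).1) (hB (e j)),
          Lp.coeFn_smul (c * (((e j).2 : ℚ) : ℝ)⁻¹) (lpRestrict (F (e j).1) (B (e j)))] with s h1 h2
        rw [h2, Pi.smul_apply, h1, norm_smul, norm_mul, Real.norm_eq_abs, hc, one_mul,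
          Real.norm_of_nonneg (inv_nonneg.2 (hr _).le)]
        by_cases hs : s ∈ B (e j)
        · rw [Set.indicator_of_mem hs, inv_mul_le_iff₀ (hr _)]
          exact hs
        · simp [hs])
    refine ⟨M, hM, ?_⟩
    filter_upwards [hle] with s hs i r hr0 hFs
    obtain ⟨j, hj⟩ := he (i, ⟨r, hr0⟩)
    have h1 := hs j
    have hmem : s ∈ B (i, ⟨r, hr0⟩) := hFs
    rw [hj, Set.indicator_of_mem hmem] at h1
    have hr0' : (0 : ℝ) < r := Rat.cast_pos.2 hr0
    rw [mul_right_comm, ← div_eq_mul_inv, div_le_iff₀ hr0'] at h1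
    linarith
  obtain ⟨M₁, hM₁, h₁⟩ := main 1 (by simp)
  obtain ⟨M₂, hM₂, h₂⟩ := main (-1) (by simp)
  refine ⟨fun s => |M₁ s| + |M₂ s|, hM₁.abs.add hM₂.abs, fun s => by positivity, ?_⟩
  filter_upwards [h₁, h₂] with s hs₁ hs₂ i r hr0 hF
  have hr0' : (0 : ℝ) < r := Rat.cast_pos.2 hr0
  have h1 := hs₁ i r hr0 hF
  have h2 := hs₂ i r hr0 hF
  have h3 := mul_le_mul_of_nonneg_left (le_abs_self (M₁ s)) hr0'.le
  have h4 := mul_le_mul_of_nonneg_left (le_abs_self (M₂ s)) hr0'.le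
  have h5 := mul_nonneg hr0'.le (abs_nonneg (M₁ s))
  have h6 := mul_nonneg hr0'.le (abs_nonneg (M₂ s))
  rw [abs_le]
  constructor <;> nlinarith

/-- Almost everywhere, the densities of a norming functional are given by functionals on `X`. -/
theorem ae_exists_dual_of_norming (hp : 1 < p) (hp' : p ≠ ⊤) {φ : Lp X p μ →L[ℝ] ℝ}
    (hφ : ‖φ‖ = 1) {f : Lp X p μ} (hf : ‖f‖ = 1) (hφf : φ f = 1) {F : ℕ → Lp X p μ}
    {t : ℕ → S → ℝ} (H : ∀ i, IsDensity φ (F i) (t i)) :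
    ∀ᵐ s ∂μ, ∃ k : X →L[ℝ] ℝ, ‖k‖ ≤ ‖f s‖ ^ (p.toReal - 1) ∧ ∀ i, k (F i s) = t i s := by
  have h1 : ∀ᵐ s ∂μ, ∀ (N : ℕ) (c : Fin N → ℚ), |∑ i, (c i : ℝ) * t i s| ≤
      ‖f s‖ ^ (p.toReal - 1) * ‖∑ i, (c i : ℝ) • F i s‖ := by
    refine ae_all_iff.2 fun N => ae_all_iff.2 fun c => ?_
    filter_upwards [(IsDensity.sum (fun i : Fin N => H i) (fun i => (c i : ℝ))
      Finset.univ).abs_le_of_norming hp hp' hφ hf hφf,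
      coeFn_sum_smul (fun i : Fin N => F i) (fun i => (c i : ℝ)) Finset.univ] with s h1 h2
    rwa [h2] at h1
  filter_upwards [h1] with s hs
  exact exists_dual_of_rat_combination_le (by positivity) _ _ hs

theorem le_mul_div_of_forall_rat {b a M θ : ℝ} (ha : 0 < a) (hb : 0 ≤ b) (hM : 0 ≤ M)
    (h : ∀ r : ℚ, 0 < r → b ≤ r * a → θ ≤ r * M) : θ ≤ M / a * b := by
  have h1 : ∀ r : ℝ, b / a < r → θ ≤ r * M := by
    intro r hr
    obtain ⟨q, hq, hqr⟩ := exists_rat_btwn hr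
    have hq0 : (0 : ℝ) < q := (by positivity : 0 ≤ b / a).trans_lt hq
    refine (h q (Rat.cast_pos.1 hq0) ?_).trans (by gcongr)
    exact ((div_lt_iff₀ ha).1 hq).le
  have h2 : θ ≤ b / a * M := by
    refine ge_of_tendsto (x := nhdsWithin (b / a) (Set.Ioi (b / a))) (f := fun r => r * M) ?_ ?_
    · exact tendsto_nhdsWithin_of_tendsto_nhds (tendsto_id.mul_const M)
    · filter_upwards [self_mem_nhdsWithin] with r hr using h1 r hr
  convert h2 using 1
  ring

/-- The densities of an arbitrary functional are given by functionals on `X` almost everywhere on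
the support of a fixed `f`, and are controlled by an integrable function relative to `‖f ·‖`. -/
theorem ae_exists_dual (ψ : Lp X p μ →L[ℝ] ℝ) (f : Lp X p μ) {F : ℕ → Lp X p μ}
    {t : ℕ → S → ℝ} (H : ∀ i, IsDensity ψ (F i) (t i)) :
    (∀ᵐ s ∂μ, f s ≠ 0 → ∃ k : X →L[ℝ] ℝ, ∀ i, k (F i s) = t i s) ∧
    ∃ M, Integrable M μ ∧ (∀ s, 0 ≤ M s) ∧
      ∀ᵐ s ∂μ, ∀ i, ∀ r : ℚ, 0 < r → ‖F i s‖ ≤ r * ‖f s‖ → |t i s| ≤ r * M s := by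
  constructor
  · obtain ⟨M, -, hM0, hM⟩ := exists_integrable_bound_of_density f
      (fun c : (Σ N : ℕ, Fin N → ℚ) => IsDensity.sum (fun i : Fin c.1 => H i)
        (fun i => (c.2 i : ℝ)) Finset.univ)
    have hcoe : ∀ᵐ s ∂μ, ∀ c : (Σ N : ℕ, Fin N → ℚ),
        (∑ i, (c.2 i : ℝ) • F i : Lp X p μ) s = ∑ i, (c.2 i : ℝ) • F i s :=
      ae_all_iff.2 fun c => coeFn_sum_smul (fun i : Fin c.1 => F i) (fun i => (c.2 i : ℝ)) _
    filter_upwards [hM, hcoe] with s hs hc hfs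
    have hfs' : 0 < ‖f s‖ := norm_pos_iff.2 hfs
    obtain ⟨k, -, hk⟩ := exists_dual_of_rat_combination_le
      (div_nonneg (hM0 s) (norm_nonneg (f s))) (fun i => F i s) (fun i => t i s)
      (fun N c => le_mul_div_of_forall_rat hfs' (norm_nonneg _) (hM0 s) fun r hr hle =>
        hs ⟨N, c⟩ r hr (by rw [hc ⟨N, c⟩]; exact hle))
    exact ⟨k, hk⟩
  · exact exists_integrable_bound_of_density f H

/-- Convergence of `ψ (y n)` from almost everywhere convergence of the densities and of the
pointwise norms, without loss of mass. -/
theorem tendsto_apply_of_ae_tendsto_density (hp' : p ≠ ⊤) {ψ : Lp X p μ →L[ℝ] ℝ} {f : Lp X p μ}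
    {y : ℕ → Lp X p μ} (hy : ∀ n, ‖y n‖ = ‖f‖) {t : S → ℝ} {u : ℕ → S → ℝ}
    (Hf : IsDensity ψ f t) (Hy : ∀ n, IsDensity ψ (y n) (u n)) {M : S → ℝ} (hM : Integrable M μ)
    (hM0 : ∀ s, 0 ≤ M s)
    (hMf : ∀ᵐ s ∂μ, ∀ r : ℚ, 0 < r → ‖f s‖ ≤ r * ‖f s‖ → |t s| ≤ r * M s)
    (hMy : ∀ᵐ s ∂μ, ∀ n, ∀ r : ℚ, 0 < r → ‖y n s‖ ≤ r * ‖f s‖ → |u n s| ≤ r * M s)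
    (hnorm : ∀ᵐ s ∂μ, Tendsto (fun n => ‖y n s‖) atTop (nhds ‖f s‖))
    (hdens : ∀ᵐ s ∂μ, f s ≠ 0 → Tendsto (fun n => u n s) atTop (nhds (t s))) :
    Tendsto (fun n => ψ (y n)) atTop (nhds (ψ f)) := by
  have hP : 0 < p.toReal := ENNReal.toReal_pos (zero_lt_one.trans_le Fact.out).ne' hp'
  set P := p.toReal
  let B : ℕ → Set S := fun n => {s | ‖y n s‖ ≤ 2 * ‖f s‖}
  have hB : ∀ n, MeasurableSet (B n) := fun n =>
    measurableSet_le (Lp.stronglyMeasurable _).norm.measurable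
      ((Lp.stronglyMeasurable _).norm.measurable.const_mul _)
  have hBev : ∀ᵐ s ∂μ, f s ≠ 0 → ∀ᶠ n in atTop, s ∈ B n := by
    filter_upwards [hnorm] with s hs hfs
    have : ‖f s‖ < 2 * ‖f s‖ := by linarith [norm_pos_iff.2 hfs]
    filter_upwards [hs.eventually_lt_const this] with n hn using hn.le
  have hsplit : ∀ n, ψ (y n) = ψ (lpRestrict (y n) (B n)) + ψ (lpRestrict (y n) (B n)ᶜ) := by
    intro n
    rw [← map_add, ← lpRestrict_union _ (hB n) (hB n).compl disjoint_compl_right,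
      Set.union_compl_self, lpRestrict_univ]
  have hzero : ∀ {x m : ℝ}, (∀ r : ℚ, 0 < r → |x| ≤ r * m) → x = 0 := by
    intro x m h
    have hm : 0 ≤ m := by simpa using (abs_nonneg x).trans (h 1 one_pos)
    have := le_mul_div_of_forall_rat one_pos le_rfl hm (fun r hr _ => h r hr)
    rw [mul_zero] at this
    exact abs_eq_zero.1 (le_antisymm this (abs_nonneg x))
  have hmain : Tendsto (fun n => ψ (lpRestrict (y n) (B n))) atTop (nhds (ψ f)) := by
    rw [Hf.apply_self]
    simp_rw [fun n => ((Hy n).restrict (hB n)).apply_self]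
    refine tendsto_integral_of_dominated_convergence (fun s => 2 * M s)
      (fun n => ((Hy n).restrict (hB n)).integrable.aestronglyMeasurable) (hM.const_mul 2)
      (fun n => ?_) ?_
    · filter_upwards [hMy] with s hs
      by_cases hsB : s ∈ B n
      · rw [Set.indicator_of_mem hsB]
        have hy2 : ‖y n s‖ ≤ 2 * ‖f s‖ := hsB
        simpa using hs n 2 two_pos (by simpa using hy2)
      · rw [Set.indicator_of_notMem hsB, norm_zero]
        linarith [hM0 s]
    · filter_upwards [hMf, hMy, hdens, hBev] with s h1 h2 h3 h4
      by_cases hfs : f s = 0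
      · have ht : t s = 0 := hzero fun r hr => h1 r hr (by simp [hfs])
        rw [ht]
        refine tendsto_const_nhds.congr fun n => ?_
        by_cases hsB : s ∈ B n
        · rw [Set.indicator_of_mem hsB]
          have hy0 : ‖y n s‖ ≤ 2 * ‖f s‖ := hsB
          rw [hfs, norm_zero, mul_zero] at hy0
          exact (hzero fun r hr => h2 n r hr (by simpa [hfs] using hy0)).symm
        · rw [Set.indicator_of_notMem hsB]
      · refine (h3 hfs).congr' ?_
        filter_upwards [h4 hfs] with n hn
        rw [Set.indicator_of_mem hn]
  have hmass : Tendsto (fun n => ∫ s in B n, ‖y n s‖ ^ P ∂μ) atTop (nhds (‖f‖ ^ P)) := by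
    rw [Lp_norm_rpow_eq_integral hp']
    simp_rw [← fun n => integral_indicator (hB n) (f := fun s => ‖y n s‖ ^ P) (μ := μ)]
    refine tendsto_integral_of_dominated_convergence (fun s => 2 ^ P * ‖f s‖ ^ P)
      (fun n => ((integrable_norm_rpow_Lp hp' (y n)).indicator (hB n)).aestronglyMeasurable)
      ((integrable_norm_rpow_Lp hp' f).const_mul _) (fun n => Eventually.of_forall fun s => ?_) ?_
    · by_cases hsB : s ∈ B n
      · rw [Set.indicator_of_mem hsB, Real.norm_of_nonneg (by positivity),
          ← Real.mul_rpow two_pos.le (norm_nonneg _)]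
        exact Real.rpow_le_rpow (norm_nonneg _) hsB hP.le
      · rw [Set.indicator_of_notMem hsB, norm_zero]
        positivity
    · filter_upwards [hnorm, hBev] with s h1 h2
      by_cases hfs : f s = 0
      · rw [hfs, norm_zero, Real.zero_rpow hP.ne']
        refine tendsto_const_nhds.congr fun n => ?_
        by_cases hsB : s ∈ B n
        · have hy0 : ‖y n s‖ ≤ 2 * ‖f s‖ := hsB
          rw [hfs, norm_zero, mul_zero] at hy0
          rw [Set.indicator_of_mem hsB, le_antisymm hy0 (norm_nonneg _), Real.zero_rpow hP.ne']
        · rw [Set.indicator_of_notMem hsB]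
      · refine (h1.rpow_const (Or.inr hP.le)).congr' ?_
        filter_upwards [h2 hfs] with n hn
        rw [Set.indicator_of_mem hn]
  have hrest : Tendsto (fun n => ‖lpRestrict (y n) (B n)ᶜ‖) atTop (nhds 0) := by
    have h1 : ∀ n, ‖lpRestrict (y n) (B n)ᶜ‖ =
        (‖f‖ ^ P - ∫ s in B n, ‖y n s‖ ^ P ∂μ) ^ P⁻¹ := by
      intro n
      rw [← hy n, Lp_norm_rpow_eq_integral hp', ← integral_add_compl (hB n)
        (integrable_norm_rpow_Lp hp' (y n)), add_sub_cancel_left,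
        ← norm_lpRestrict_rpow hp' _ (hB n).compl, Real.rpow_rpow_inv (norm_nonneg _) hP.ne']
    simp_rw [h1]
    have := (hmass.const_sub (‖f‖ ^ P)).rpow_const (p := P⁻¹) (Or.inr (by positivity))
    simpa [Real.zero_rpow (inv_ne_zero hP.ne')] using this
  have hrest' : Tendsto (fun n => ψ (lpRestrict (y n) (B n)ᶜ)) atTop (nhds 0) :=
    squeeze_zero_norm (fun n => ψ.le_opNorm _) (by simpa using hrest.const_mul ‖ψ‖)
  simp_rw [hsplit]
  simpa using hmain.add hrest'

end Density

/-- If `μ` is σ-finite, `1 < p < ∞` and `X` is a very convex real Banach space, then the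
Lebesgue–Bochner space `L^p(μ, X)` is very convex. -/
theorem Lp_veryConvex {S : Type*} [MeasurableSpace S] (μ : Measure S) [SigmaFinite μ]
    (p : ℝ≥0∞) [Fact (1 ≤ p)] (hp : 1 < p) (hp' : p ≠ ⊤)
    (X : Type*) [NormedAddCommGroup X] [NormedSpace ℝ X] [CompleteSpace X]
    (hX : VeryConvexSpace X) :
    VeryConvexSpace (Lp X p μ) := by
  intro xs hxs f hf φ hφ hφf hφxs ψ
  have hP : 1 < p.toReal := by simpa using (ENNReal.toReal_lt_toReal ENNReal.one_ne_top hp').2 hp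
  let F : ℕ → Lp X p μ := fun n => Nat.casesOn n f xs
  choose tφ hφd using fun i => exists_isDensity hp' φ (F i)
  choose tψ hψd using fun i => exists_isDensity hp' ψ (F i)
  have hg := ae_exists_dual_of_norming hp hp' hφ hf hφf hφd
  obtain ⟨hk, M, hM, hM0, hMle⟩ := ae_exists_dual ψ f hψd
  have hfint : ∫ s, ‖f s‖ ^ p.toReal ∂μ = 1 := by
    rw [← Lp_norm_rpow_eq_integral hp', hf, Real.one_rpow]
  have hxint : ∀ n, ∫ s, ‖xs n s‖ ^ p.toReal ∂μ = 1 := fun n => by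
    rw [← Lp_norm_rpow_eq_integral hp', hxs, Real.one_rpow]
  have hgle : ∀ᵐ s ∂μ, ∀ i, tφ i s ≤ ‖f s‖ ^ (p.toReal - 1) * ‖F i s‖ := by
    filter_upwards [hg] with s ⟨k, hk, hki⟩ i
    rw [← hki]
    exact (le_abs_self _).trans ((k.le_opNorm _).trans (by gcongr))
  have ht0 : ∀ᵐ s ∂μ, tφ 0 s = ‖f s‖ ^ p.toReal := by
    have hle : ∀ᵐ s ∂μ, tφ 0 s ≤ ‖f s‖ ^ p.toReal := by
      filter_upwards [hgle] with s hs
      exact (hs 0).trans_eq (rpow_sub_one_mul_self hP (norm_nonneg _))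
    refine (integral_eq_iff_of_ae_le (hφd 0).integrable (integrable_norm_rpow_Lp hp' f) hle).1 ?_
    rw [hfint, ← (hφd 0).apply_self]
    exact hφf
  let G : ℕ → S → ℝ := fun n s => ‖f s‖ ^ p.toReal * (1 - p.toReal⁻¹) +
    ‖xs n s‖ ^ p.toReal * p.toReal⁻¹ - tφ (n + 1) s
  have hGint₁ : ∀ n, Integrable (fun s => ‖f s‖ ^ p.toReal * (1 - p.toReal⁻¹) +
      ‖xs n s‖ ^ p.toReal * p.toReal⁻¹) μ := fun n =>
    ((integrable_norm_rpow_Lp hp' f).mul_const _).add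
      ((integrable_norm_rpow_Lp hp' (xs n)).mul_const _)
  have hGint : ∀ n, Integrable (G n) μ := fun n => (hGint₁ n).sub (hφd (n + 1)).integrable
  have hG0 : ∀ n, 0 ≤ᵐ[μ] G n := by
    intro n
    filter_upwards [hgle] with s hs
    have h1 := rpow_sub_one_mul_le hP (norm_nonneg (f s)) (norm_nonneg (xs n s))
    have h2 : tφ (n + 1) s ≤ ‖f s‖ ^ (p.toReal - 1) * ‖xs n s‖ := hs (n + 1)
    simp only [G, Pi.zero_apply]
    linarith
  have hGval : ∀ n, ∫ s, G n s ∂μ = 1 - φ (xs n) := by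
    intro n
    have h1 : φ (xs n) = ∫ s, tφ (n + 1) s ∂μ := (hφd (n + 1)).apply_self
    simp only [G]
    rw [integral_sub (hGint₁ n) (hφd (n + 1)).integrable, integral_add
      ((integrable_norm_rpow_Lp hp' f).mul_const _)
      ((integrable_norm_rpow_Lp hp' (xs n)).mul_const _), integral_mul_const, integral_mul_const,
      hfint, hxint, h1]
    ring
  have hGL : Tendsto (fun n => eLpNorm (G n - 0) 1 μ) atTop (nhds 0) := by
    have h1 : ∀ n, eLpNorm (G n - 0) 1 μ = ENNReal.ofReal (1 - φ (xs n)) := by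
      intro n
      rw [sub_zero, eLpNorm_one_eq_lintegral_enorm, ← hGval,
        ofReal_integral_eq_lintegral_ofReal (hGint n) (hG0 n)]
      refine lintegral_congr_ae ?_
      filter_upwards [hG0 n] with s hs
      exact Real.enorm_of_nonneg hs
    simp_rw [h1]
    simpa using ENNReal.tendsto_ofReal (hφxs.const_sub 1)
  refine tendsto_of_subseq_tendsto fun ns hns => ?_
  obtain ⟨ms, -, hms⟩ := (tendstoInMeasure_of_tendsto_eLpNorm one_ne_zero
    (fun n => (hGint (ns n)).aestronglyMeasurable) aestronglyMeasurable_zero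
    (hGL.comp hns)).exists_seq_tendsto_ae
  refine ⟨ms, ?_⟩
  have hpt : ∀ᵐ s ∂μ, Tendsto (fun n => ‖xs (ns (ms n)) s‖) atTop (nhds ‖f s‖) ∧
      ∀ k : X →L[ℝ] ℝ, Tendsto (fun n => k (xs (ns (ms n)) s)) atTop (nhds (k (f s))) := by
    filter_upwards [hg, ht0, hms] with s ⟨g, hgn, hgi⟩ h0 hlim
    refine hX.tendsto_of_gap hP hgn ((hgi 0).trans h0) (hlim.congr fun n => ?_)
    have h1 : g (xs (ns (ms n)) s) = tφ (ns (ms n) + 1) s := hgi (ns (ms n) + 1)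
    simp only [G, h1]
  refine tendsto_apply_of_ae_tendsto_density hp' (fun n => by rw [hxs, hf]) (hψd 0)
    (fun n => hψd (ns (ms n) + 1)) hM hM0 ?_ ?_ ?_ ?_
  · filter_upwards [hMle] with s hs using hs 0
  · filter_upwards [hMle] with s hs n using hs (ns (ms n) + 1)
  · filter_upwards [hpt] with s hs using hs.1
  · filter_upwards [hpt, hk] with s hs hks hfs
    obtain ⟨k, hk⟩ := hks hfs
    have h1 : k (f s) = tψ 0 s := hk 0
    rw [← h1]
    exact (hs.2 k).congr fun n => hk (ns (ms n) + 1)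
end

section
/- Let (S, 𝒜, μ) be a measure space, let 1 < p < ∞, and let X be a uniformly convex real Banach space. Then for every ε ∈ (0, 2) there exists α > 0 with the following property: whenever f, g ∈ L^p(μ, X) satisfy ‖f‖_p = ‖g‖_p = 1, ‖f(s)‖ = ‖g(s)‖ for almost every s ∈ S, and ‖f − g‖_p ≥ ε, then ‖f + g‖_p ≤ 2(1 − α). -/
open scoped ENNReal
open MeasureTheory

/-- In a uniformly convex space, `‖x - y‖ ^ q` is controlled, for vectors of equal norm `t`, by
`(η * t) ^ q` and the defect `(2 * t) ^ q - ‖x + y‖ ^ q`. -/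
theorem exists_norm_sub_rpow_le_of_norm_eq (X : Type*) [NormedAddCommGroup X] [NormedSpace ℝ X]
    [UniformConvexSpace X] {q η : ℝ} (hq : 0 < q) (hη : 0 < η) :
    ∃ C : ℝ, 0 < C ∧ ∀ x y : X, ‖x‖ = ‖y‖ →
      ‖x - y‖ ^ q ≤ η ^ q * ‖x‖ ^ q + C * (2 ^ q * ‖x‖ ^ q - ‖x + y‖ ^ q) := by
  obtain ⟨δ, hδ, h⟩ := exists_forall_sphere_dist_add_le_two_sub X hη
  set r : ℝ := 2 - min δ 1 with hr
  have hδ1 : 0 < min δ 1 := lt_min hδ one_pos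
  have hr0 : 0 ≤ r := by linarith [min_le_right δ 1]
  have hgap : 0 < (2 : ℝ) ^ q - r ^ q :=
    sub_pos.2 (Real.rpow_lt_rpow hr0 (by linarith) hq)
  have h2q : (0 : ℝ) < 2 ^ q := Real.rpow_pos_of_pos two_pos q
  refine ⟨2 ^ q / (2 ^ q - r ^ q), div_pos h2q hgap, fun x y hxy => ?_⟩
  have hC := div_pos h2q hgap
  have hxq : 0 ≤ ‖x‖ ^ q := Real.rpow_nonneg (norm_nonneg x) q
  have hηq : 0 ≤ η ^ q := Real.rpow_nonneg hη.le q
  have hadd : ‖x + y‖ ^ q ≤ 2 ^ q * ‖x‖ ^ q := by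
    rw [← Real.mul_rpow two_pos.le (norm_nonneg x)]
    exact Real.rpow_le_rpow (norm_nonneg _) (by linarith [norm_add_le x y]) hq.le
  have hsub : ‖x - y‖ ^ q ≤ 2 ^ q * ‖x‖ ^ q := by
    rw [← Real.mul_rpow two_pos.le (norm_nonneg x)]
    exact Real.rpow_le_rpow (norm_nonneg _) (by linarith [norm_sub_le x y]) hq.le
  obtain hle | hlt := le_or_gt ‖x - y‖ (η * ‖x‖)
  · have := Real.rpow_le_rpow (norm_nonneg _) hle hq.le
    rw [Real.mul_rpow hη.le (norm_nonneg x)] at this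
    nlinarith [mul_nonneg hC.le (sub_nonneg.2 hadd)]
  · have hx : 0 < ‖x‖ := by
      refine (norm_nonneg x).lt_of_ne fun h0 => ?_
      rw [← h0] at hxy
      rw [norm_eq_zero.1 h0.symm, norm_eq_zero.1 hxy.symm] at hlt
      simp at hlt
    have hunit : ∀ z : X, ‖‖x‖⁻¹ • z‖ = ‖z‖ / ‖x‖ := fun z => by
      rw [norm_smul, norm_inv, norm_norm, div_eq_inv_mul]
    have key : ‖x + y‖ ≤ r * ‖x‖ := by
      have := h (x := ‖x‖⁻¹ • x) (by rw [hunit, div_self hx.ne'])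
        (y := ‖x‖⁻¹ • y) (by rw [hunit, ← hxy, div_self hx.ne'])
        (by rw [← smul_sub, hunit, le_div_iff₀ hx]; exact hlt.le)
      rw [← smul_add, hunit, div_le_iff₀ hx] at this
      exact this.trans (mul_le_mul_of_nonneg_right
        (by linarith [min_le_left δ 1]) hx.le)
    have hkey := Real.rpow_le_rpow (norm_nonneg _) key hq.le
    rw [Real.mul_rpow hr0 hx.le] at hkey
    calc ‖x - y‖ ^ q ≤ 2 ^ q * ‖x‖ ^ q := hsub
      _ = 2 ^ q / (2 ^ q - r ^ q) * (2 ^ q * ‖x‖ ^ q - r ^ q * ‖x‖ ^ q) := by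
        field_simp
      _ ≤ 2 ^ q / (2 ^ q - r ^ q) * (2 ^ q * ‖x‖ ^ q - ‖x + y‖ ^ q) := by
        gcongr
      _ ≤ _ := le_add_of_nonneg_left (mul_nonneg hηq hxq)

/-- For `0 < p < ∞`, the `p`-th power of the norm in `L^p` is the integral of `‖f‖ ^ p`. -/
theorem Lp_norm_rpow_eq_integral_s10 {S E : Type*} [MeasurableSpace S] {μ : Measure S}
    [NormedAddCommGroup E] {p : ℝ≥0∞} (hp0 : p ≠ 0) (hp' : p ≠ ⊤) (f : Lp E p μ) :
    ‖f‖ ^ p.toReal = ∫ s, ‖f s‖ ^ p.toReal ∂μ := by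
  have hint : 0 ≤ ∫ s, ‖f s‖ ^ p.toReal ∂μ :=
    integral_nonneg fun s => Real.rpow_nonneg (norm_nonneg _) _
  rw [Lp.norm_def, (Lp.memLp f).eLpNorm_eq_integral_rpow_norm hp0 hp',
    ENNReal.toReal_ofReal (Real.rpow_nonneg hint _),
    Real.rpow_inv_rpow hint (ENNReal.toReal_pos hp0 hp').ne']

/-- If `1 < p < ∞` and `X` is a uniformly convex real Banach space, then for every
`ε ∈ (0, 2)` there is `α > 0` such that whenever `f, g ∈ L^p(μ, X)` have norm one,
`‖f(s)‖ = ‖g(s)‖` for a.e. `s`, and `‖f − g‖_p ≥ ε`, then `‖f + g‖_p ≤ 2(1 − α)`. -/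
theorem Lp_uniformConvex_equalNorms {S : Type*} [MeasurableSpace S] (μ : Measure S)
    (p : ℝ≥0∞) [Fact (1 ≤ p)] (hp : 1 < p) (hp' : p ≠ ⊤)
    (X : Type*) [NormedAddCommGroup X] [NormedSpace ℝ X] [CompleteSpace X]
    [UniformConvexSpace X] :
    ∀ ε : ℝ, 0 < ε → ε < 2 → ∃ α : ℝ, 0 < α ∧
      ∀ f g : Lp X p μ, ‖f‖ = 1 → ‖g‖ = 1 →
        (∀ᵐ s ∂μ, ‖f s‖ = ‖g s‖) → ε ≤ ‖f - g‖ →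
        ‖f + g‖ ≤ 2 * (1 - α) := by
  intro ε hε _
  have hp0 : p ≠ 0 := (zero_lt_one.trans hp).ne'
  have hq : 0 < p.toReal := ENNReal.toReal_pos hp0 hp'
  set q := p.toReal
  obtain ⟨C, hC, hpt⟩ := exists_norm_sub_rpow_le_of_norm_eq X hq (half_pos hε)
  have hgap : 0 < ε ^ q - (ε / 2) ^ q :=
    sub_pos.2 (Real.rpow_lt_rpow (half_pos hε).le (half_lt_self hε) hq)
  set M : ℝ := max (2 ^ q - (ε ^ q - (ε / 2) ^ q) / C) 0
  have hM0 : 0 ≤ M := le_max_right _ _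
  have hM : M ^ q⁻¹ < 2 := by
    rw [Real.rpow_inv_lt_iff_of_pos hM0 two_pos.le hq]
    exact max_lt (sub_lt_self _ (div_pos hgap hC)) (Real.rpow_pos_of_pos two_pos q)
  refine ⟨1 - M ^ q⁻¹ / 2, by linarith, fun f g hf _ hfg hsub => ?_⟩
  have hint : ∀ h : Lp X p μ, Integrable (fun s => ‖h s‖ ^ q) μ := fun h =>
    (Lp.memLp h).integrable_norm_rpow hp0 hp'
  have hineq : ‖f - g‖ ^ q ≤
      (ε / 2) ^ q * ‖f‖ ^ q + C * (2 ^ q * ‖f‖ ^ q - ‖f + g‖ ^ q) := by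
    have hmain : Integrable (fun s => (ε / 2) ^ q * ‖f s‖ ^ q) μ := (hint f).const_mul _
    have hdefect : Integrable (fun s => C * (2 ^ q * ‖f s‖ ^ q - ‖(f + g) s‖ ^ q)) μ :=
      (((hint f).const_mul _).sub (hint (f + g))).const_mul _
    rw [Lp_norm_rpow_eq_integral_s10 hp0 hp', Lp_norm_rpow_eq_integral_s10 hp0 hp',
      Lp_norm_rpow_eq_integral_s10 hp0 hp', ← integral_const_mul, ← integral_const_mul,
      ← integral_sub ((hint f).const_mul _) (hint (f + g)), ← integral_const_mul,
      ← integral_add hmain hdefect]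
    refine integral_mono_ae (hint (f - g)) (hmain.add hdefect) ?_
    filter_upwards [hfg, Lp.coeFn_add f g, Lp.coeFn_sub f g] with s hs hadd hsub
    simpa only [hadd, hsub, Pi.add_apply, Pi.sub_apply] using hpt (f s) (g s) hs
  rw [hf, Real.one_rpow, mul_one, mul_one] at hineq
  have hεq : ε ^ q ≤ ‖f - g‖ ^ q := Real.rpow_le_rpow hε.le hsub hq.le
  have hN : ‖f + g‖ ^ q ≤ M := by
    refine le_trans ?_ (le_max_left _ _)
    rw [le_sub_comm, div_le_iff₀' hC]
    linarith
  have := (Real.le_rpow_inv_iff_of_pos (norm_nonneg (f + g)) hM0 hq).2 hN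
  linarith
end
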